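/- Let α, β > −1, N ≥ 1 and 0 ≤ j ≤ N−1. Then for every f ∈ C_c^∞(0,π) and every θ ∈ (0,π): ∂_θ^j (𝒥^{−N/2}Π₀f)(θ) = ∫₀^π ∂_θ^j K̃_{N/2}(θ,φ) f(φ) dμ(φ), the integral converging absolutely. -/

import Mathlib

open MeasureTheory Real Set Filter
open scoped Classical

noncomputable section

/-- The Jacobi measure dμ_{α,β} on (0,π). -/
def jacobiMeasure (α β : ℝ) : Measure ℝ :=
  (volume.restrict (Set.Ioo 0 π)).withDensity
    (fun θ => ENNReal.ofReal ((Real.sin (θ/2)) ^ (2*α+1) * (Real.cos (θ/2)) ^ (2*β+1)))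

/-- The classical Jacobi polynomial `P_n^{(α,β)}`. -/
def jacobiPoly (α β : ℝ) (n : ℕ) (x : ℝ) : ℝ :=
  ∑ k ∈ Finset.range (n+1),
    (Real.Gamma ((n:ℝ)+α+1) / (Real.Gamma (α+(k:ℝ)+1) * (Nat.factorial (n-k)))) *
    (Real.Gamma ((n:ℝ)+β+1) / (Real.Gamma ((n:ℝ)+β-(k:ℝ)+1) * (Nat.factorial k))) *
    ((x-1)/2)^k * ((x+1)/2)^(n-k)

/-- Normalized trigonometric Jacobi polynomial `𝒫_n(θ) = c_n P_n^{(α,β)}(cos θ)`. -/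
def nJacobi (α β : ℝ) (c : ℕ → ℝ) (n : ℕ) (θ : ℝ) : ℝ :=
  c n * jacobiPoly α β n (Real.cos θ)

def jacobiTau (α β : ℝ) : ℝ := (α + β + 1) / 2

/-- `c` is an admissible sequence of (positive) normalizing constants. -/
def JacobiNormalized (α β : ℝ) (c : ℕ → ℝ) : Prop :=
  (∀ n, 0 < c n) ∧
  ∀ n, ∫ θ, (nJacobi α β c n θ)^2 ∂(jacobiMeasure α β) = 1

/-- The Jacobi-Poisson kernel. -/
def poissonKer (α β : ℝ) (c : ℕ → ℝ) (t θ φ : ℝ) : ℝ :=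
  ∑' n : ℕ, Real.exp (-t * |(n:ℝ) + jacobiTau α β|) * nJacobi α β c n θ * nJacobi α β c n φ

/-- The Riesz-Jacobi kernel of order `N`. -/
def rieszKer (α β : ℝ) (c : ℕ → ℝ) (N : ℕ) (θ φ : ℝ) : ℝ :=
  (1 / Real.Gamma (N:ℝ)) *
    ∫ t in Set.Ioi (0:ℝ), iteratedDeriv N (fun θ' => poissonKer α β c t θ' φ) θ * t ^ (N-1)

/-- Inner product in `L²(dμ_{α,β})`. -/
def jacobiInner (α β : ℝ) (f g : ℝ → ℝ) : ℝ := ∫ θ, f θ * g θ ∂(jacobiMeasure α β)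

/-- The Riesz-Jacobi transform of order `N` on test functions. -/
def rieszTransform (α β : ℝ) (c : ℕ → ℝ) (N : ℕ) (f : ℝ → ℝ) (θ : ℝ) : ℝ :=
  ∑' n : ℕ, |((n:ℝ)+1) + jacobiTau α β| ^ (-(N:ℝ)) *
    jacobiInner α β f (nJacobi α β c (n+1)) *
    iteratedDeriv N (nJacobi α β c (n+1)) θ

/-- `f ∈ C_c^∞(0,π)`. -/
def IsCcSmooth (f : ℝ → ℝ) : Prop :=
  ContDiff ℝ (⊤ : ℕ∞) f ∧ HasCompactSupport f ∧ tsupport f ⊆ Set.Ioo 0 π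

/-- The compensated Jacobi-Poisson kernel
`H̃_t(θ,φ) = H_t(θ,φ) − exp(−t|τ|) 𝒫₀(θ) 𝒫₀(φ)`. -/
def tildePoissonKer (α β : ℝ) (c : ℕ → ℝ) (t θ φ : ℝ) : ℝ :=
  poissonKer α β c t θ φ -
    Real.exp (-t * |jacobiTau α β|) * nJacobi α β c 0 θ * nJacobi α β c 0 φ

/-- The compensated potential kernel `K̃_{N/2}(θ,φ)` (for `σ = N/2`, so that
`Γ(2σ) = Γ(N)` and `t^{2σ−1} = t^{N−1}`). -/
def tildePotentialKer (α β : ℝ) (c : ℕ → ℝ) (N : ℕ) (θ φ : ℝ) : ℝ :=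
  (1 / Real.Gamma (N:ℝ)) *
    ∫ t in Set.Ioi (0:ℝ), tildePoissonKer α β c t θ φ * t ^ (N-1)
/-- The negative power `𝒥^{−N/2}Π₀ f(θ) = Σ_{n=1}^∞ |n+τ|^{−N} ⟨f,𝒫_n⟩ 𝒫_n(θ)`. -/
def jacobiNegPow (α β : ℝ) (c : ℕ → ℝ) (N : ℕ) (f : ℝ → ℝ) (θ : ℝ) : ℝ :=
  ∑' n : ℕ, |((n:ℝ)+1) + jacobiTau α β| ^ (-(N:ℝ)) *
    jacobiInner α β f (nJacobi α β c (n+1)) * nJacobi α β c (n+1) θ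


/-! ### Part 1: the polynomials -/

def jacC (α β : ℝ) (n k : ℕ) : ℝ :=
  (Real.Gamma ((n:ℝ)+α+1) / (Real.Gamma (α+(k:ℝ)+1) * (Nat.factorial (n-k)))) *
    (Real.Gamma ((n:ℝ)+β+1) / (Real.Gamma ((n:ℝ)+β-(k:ℝ)+1) * (Nat.factorial k)))

def jacR (α β : ℝ) (n : ℕ) : Polynomial ℝ :=
  ∑ k ∈ Finset.range (n+1),
    Polynomial.C (jacC α β n k) * (Polynomial.X ^ k * (Polynomial.X + 1) ^ (n-k))

lemma jacobiPoly_eq (α β : ℝ) (n : ℕ) (x : ℝ) :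
    jacobiPoly α β n x = (jacR α β n).eval ((x-1)/2) := by
  unfold jacobiPoly jacR jacC
  rw [Polynomial.eval_finsetSum]
  refine Finset.sum_congr rfl fun k _ => ?_
  simp only [Polynomial.eval_mul, Polynomial.eval_C, Polynomial.eval_pow, Polynomial.eval_X,
    Polynomial.eval_add, Polynomial.eval_one]
  have : (x-1)/2 + 1 = (x+1)/2 := by ring
  rw [this]; ring

lemma jacC_pos {α β : ℝ} (hα : -1 < α) (hβ : -1 < β) {n k : ℕ} (hk : k ≤ n) :
    0 < jacC α β n k := by
  have hkn : (k:ℝ) ≤ n := by exact_mod_cast hk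
  have h0 : (0:ℝ) ≤ k := Nat.cast_nonneg k
  unfold jacC
  have h1 := Real.Gamma_pos_of_pos (s := (n:ℝ)+α+1) (by linarith)
  have h2 := Real.Gamma_pos_of_pos (s := α+(k:ℝ)+1) (by linarith)
  have h3 := Real.Gamma_pos_of_pos (s := (n:ℝ)+β+1) (by linarith)
  have h4 := Real.Gamma_pos_of_pos (s := (n:ℝ)+β-(k:ℝ)+1) (by linarith)
  have h5 : (0:ℝ) < Nat.factorial (n-k) := by exact_mod_cast Nat.factorial_pos _
  have h6 : (0:ℝ) < Nat.factorial k := by exact_mod_cast Nat.factorial_pos _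
  positivity

lemma jacC_succ {α β : ℝ} (hα : -1 < α) (hβ : -1 < β) (k m : ℕ) :
    jacC α β (k+1+m) (k+1) * ((k:ℝ)+1) * ((k:ℝ)+1+α) =
      jacC α β (k+1+m) k * ((m:ℝ)+1) * ((m:ℝ)+1+β) := by
  have h0 : (0:ℝ) ≤ k := Nat.cast_nonneg k
  have hm : (0:ℝ) ≤ m := Nat.cast_nonneg m
  unfold jacC
  have e1 : k + 1 + m - (k+1) = m := by omega
  have e2 : k + 1 + m - k = m + 1 := by omega
  rw [e1, e2, Nat.factorial_succ, Nat.factorial_succ]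
  push_cast
  have g1 : Real.Gamma (α + ((k:ℝ)+1) + 1) = (α+k+1) * Real.Gamma (α+k+1) := by
    rw [← Real.Gamma_add_one (by linarith)]; ring_nf
  have g2 : Real.Gamma ((k:ℝ)+1+m+β-k+1) = (m+1+β) * Real.Gamma (m+1+β) := by
    rw [← Real.Gamma_add_one (by linarith)]; ring_nf
  have g3 : (k:ℝ)+1+m+β-(k+1)+1 = m+1+β := by ring
  rw [g1, g2, g3]
  have h2 := Real.Gamma_pos_of_pos (s := α+(k:ℝ)+1) (by linarith)
  have h4 := Real.Gamma_pos_of_pos (s := (m:ℝ)+1+β) (by linarith)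
  have h5 : (0:ℝ) < Nat.factorial m := by exact_mod_cast Nat.factorial_pos _
  have h6 : (0:ℝ) < Nat.factorial k := by exact_mod_cast Nat.factorial_pos _
  have h7 : 0 < α + k + 1 := by linarith
  have h8 : 0 < m + 1 + β := by linarith
  field_simp
  ring

/-- one term of the ODE -/
lemma jac_term (α β y : ℝ) (k m : ℕ) :
    y * (y+1) * (Polynomial.derivative (Polynomial.derivative
        ((Polynomial.X : Polynomial ℝ) ^ k * (Polynomial.X + 1) ^ m))).eval y
      + ((α+1)*(y+1) + (β+1)*y) * (Polynomial.derivative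
        ((Polynomial.X : Polynomial ℝ) ^ k * (Polynomial.X + 1) ^ m)).eval y
      - ((k:ℝ)+m) * ((k:ℝ)+m+α+β+1) * (y^k * (y+1)^m)
    = (k:ℝ) * (k+α) * (y^(k-1) * (y+1)^m) - (m:ℝ)*(m+β) * (y^k * (y+1)^(m-1)) := by
  rcases k with _ | _ | k <;> rcases m with _ | _ | m <;>
    simp [Polynomial.derivative_mul, Polynomial.derivative_X_pow, Polynomial.derivative_X_add_C_pow, Polynomial.derivative_pow] <;> ring

lemma jacR_ode {α β : ℝ} (hα : -1 < α) (hβ : -1 < β) (n : ℕ) (y : ℝ) :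
    y * (y+1) * (Polynomial.derivative (Polynomial.derivative (jacR α β n))).eval y
      + ((α+1)*(y+1) + (β+1)*y) * (Polynomial.derivative (jacR α β n)).eval y
      = (n:ℝ) * ((n:ℝ)+α+β+1) * (jacR α β n).eval y := by
  set U : ℕ → ℝ := fun k => jacC α β n k * ((k:ℝ) * (k+α) * (y^(k-1) * (y+1)^(n-k))) with hU
  have hU' : ∀ k ∈ Finset.range (n+1), y * (y+1) * (jacC α β n k * (Polynomial.derivative (Polynomial.derivative
        ((Polynomial.X : Polynomial ℝ) ^ k * (Polynomial.X + 1) ^ (n-k)))).eval y)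
      + ((α+1)*(y+1) + (β+1)*y) * (jacC α β n k * (Polynomial.derivative
        ((Polynomial.X : Polynomial ℝ) ^ k * (Polynomial.X + 1) ^ (n-k))).eval y)
      - (n:ℝ) * ((n:ℝ)+α+β+1) * (jacC α β n k * (y^k * (y+1)^(n-k)))
      = U k - (if k < n then U (k+1) else 0) := by
    intro k hk
    have hk' : k ≤ n := by simpa [Nat.lt_succ_iff] using hk
    have ht := jac_term α β y k (n-k)
    obtain ⟨m, rfl⟩ := Nat.exists_eq_add_of_le hk'
    rw [Nat.add_sub_cancel_left] at *
    push_cast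
    have : U k - (if k < k + m then U (k+1) else 0) = jacC α β (k+m) k * ((k:ℝ) * (k+α) * (y^(k-1) * (y+1)^m) - (m:ℝ)*(m+β) * (y^k * (y+1)^(m-1))) := by
      rcases m with _ | m
      · simp [hU]
      · have hs := jacC_succ hα hβ k m
        have e : k + (m+1) = k+1+m := by ring
        simp only [hU]
        rw [if_pos (by omega), e]
        have e1 : k + 1 + m - (k+1) = m := by omega
        have e2 : k + 1 + m - k = m + 1 := by omega
        rw [e1, e2]
        simp only [Nat.add_sub_cancel]
        push_cast
        linear_combination (-(y^k * (y+1)^m)) * hs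
    rw [this, ← ht]
    ring
  have hsum := Finset.sum_congr rfl hU'
  have htel : ∑ k ∈ Finset.range (n+1), (U k - (if k < n then U (k+1) else 0)) = 0 := by
    rw [Finset.sum_sub_distrib, Finset.sum_range_succ' U, Finset.sum_range_succ (fun k => if k < n then U (k+1) else 0)]
    have : ∑ k ∈ Finset.range n, (if k < n then U (k+1) else 0) = ∑ k ∈ Finset.range n, U (k+1) :=
      Finset.sum_congr rfl fun k hk => if_pos (by simpa using hk)
    rw [this]; simp [hU]
  rw [htel, Finset.sum_sub_distrib, Finset.sum_add_distrib, ← Finset.mul_sum, ← Finset.mul_sum, ← Finset.mul_sum] at hsum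
  have r0 : (jacR α β n).eval y = ∑ k ∈ Finset.range (n+1), jacC α β n k * (y^k * (y+1)^(n-k)) := by
    simp [jacR, Polynomial.eval_finsetSum]
  have r1 : (Polynomial.derivative (jacR α β n)).eval y = ∑ k ∈ Finset.range (n+1), jacC α β n k * (Polynomial.derivative
        ((Polynomial.X : Polynomial ℝ) ^ k * (Polynomial.X + 1) ^ (n-k))).eval y := by
    unfold jacR
    rw [Polynomial.derivative_sum, Polynomial.eval_finsetSum]
    exact Finset.sum_congr rfl fun k _ => by rw [Polynomial.derivative_C_mul, Polynomial.eval_C_mul]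
  have r2 : (Polynomial.derivative (Polynomial.derivative (jacR α β n))).eval y = ∑ k ∈ Finset.range (n+1), jacC α β n k * (Polynomial.derivative (Polynomial.derivative
        ((Polynomial.X : Polynomial ℝ) ^ k * (Polynomial.X + 1) ^ (n-k)))).eval y := by
    unfold jacR
    rw [Polynomial.derivative_sum, Polynomial.derivative_sum, Polynomial.eval_finsetSum]
    exact Finset.sum_congr rfl fun k _ => by
      rw [Polynomial.derivative_C_mul, Polynomial.derivative_C_mul, Polynomial.eval_C_mul]
  rw [r0, r1, r2]
  linarith

lemma jacR_degree_le (α β : ℝ) (n : ℕ) : (jacR α β n).natDegree ≤ n := by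
  unfold jacR
  refine Polynomial.natDegree_sum_le_of_forall_le _ _ fun k hk => ?_
  have hk' : k ≤ n := by simpa [Nat.lt_succ_iff] using hk
  have h1 : ((Polynomial.X : Polynomial ℝ) + 1) ^ (n-k) = ((Polynomial.X : Polynomial ℝ) + Polynomial.C 1) ^ (n-k) := by simp
  rw [h1]
  refine (Polynomial.natDegree_C_mul_le _ _).trans ?_
  refine Polynomial.natDegree_mul_le.trans ?_
  rw [Polynomial.natDegree_X_pow, Polynomial.natDegree_pow, Polynomial.natDegree_X_add_C]
  omega

lemma jacR_coeff_pos {α β : ℝ} (hα : -1 < α) (hβ : -1 < β) (n : ℕ) : 0 < (jacR α β n).coeff n := by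
  unfold jacR
  rw [Polynomial.finsetSum_coeff]
  refine Finset.sum_pos (fun k hk => ?_) (by simp)
  have hk' : k ≤ n := by simpa [Nat.lt_succ_iff] using hk
  have h1 : ((Polynomial.X : Polynomial ℝ) ^ k * (Polynomial.X + 1) ^ (n-k)).coeff n = 1 := by
    have hm : ((Polynomial.X : Polynomial ℝ) ^ k * (Polynomial.X + Polynomial.C 1) ^ (n-k)).Monic :=
      (Polynomial.monic_X_pow k).mul ((Polynomial.monic_X_add_C 1).pow _)
    have hd : ((Polynomial.X : Polynomial ℝ) ^ k * (Polynomial.X + Polynomial.C 1) ^ (n-k)).natDegree = n := by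
      rw [(Polynomial.monic_X_pow k).natDegree_mul ((Polynomial.monic_X_add_C 1).pow _),
        Polynomial.natDegree_X_pow, Polynomial.natDegree_pow, Polynomial.natDegree_X_add_C]
      omega
    have := hm.coeff_natDegree
    rw [hd] at this
    simpa using this
  rw [Polynomial.coeff_C_mul, h1, mul_one]
  exact jacC_pos hα hβ hk'



/-! ### Part 2: trigonometric functions, weight -/

def jacU (θ : ℝ) : ℝ := (Real.cos θ - 1)/2

def jacQ (α β : ℝ) (c : ℕ → ℝ) (n : ℕ) : Polynomial ℝ := Polynomial.C (c n) * jacR α β n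

def jacLam (α β : ℝ) (n : ℕ) : ℝ := (n:ℝ) * ((n:ℝ)+α+β+1)

def jacB (α β θ : ℝ) : ℝ := (α+1/2) * (1 + Real.cos θ) + (β+1/2) * (Real.cos θ - 1)

def jacW (α β θ : ℝ) : ℝ := (Real.sin (θ/2)) ^ (2*α+1) * (Real.cos (θ/2)) ^ (2*β+1)

lemma nJacobi_eq (α β : ℝ) (c : ℕ → ℝ) (n : ℕ) (θ : ℝ) :
    nJacobi α β c n θ = (jacQ α β c n).eval (jacU θ) := by
  simp [nJacobi, jacQ, jacU, jacobiPoly_eq]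

lemma jacQ_ode {α β : ℝ} (hα : -1 < α) (hβ : -1 < β) (c : ℕ → ℝ) (n : ℕ) (y : ℝ) :
    y * (y+1) * (Polynomial.derivative (Polynomial.derivative (jacQ α β c n))).eval y
      + ((α+1)*(y+1) + (β+1)*y) * (Polynomial.derivative (jacQ α β c n)).eval y
      = jacLam α β n * (jacQ α β c n).eval y := by
  have h := jacR_ode hα hβ n y
  simp only [jacQ, Polynomial.derivative_C_mul, Polynomial.eval_C_mul, jacLam]
  linear_combination c n * h

lemma jacU_hasDerivAt (θ : ℝ) : HasDerivAt jacU (-(Real.sin θ)/2) θ := by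
  unfold jacU
  exact ((Real.hasDerivAt_cos θ).sub_const 1).div_const 2

lemma jacU_contDiff : ContDiff ℝ (⊤ : ℕ∞) jacU := by
  unfold jacU; fun_prop

lemma jacB_contDiff (α β : ℝ) : ContDiff ℝ (⊤ : ℕ∞) (jacB α β) := by
  unfold jacB; fun_prop

lemma nJacobi_contDiff (α β : ℝ) (c : ℕ → ℝ) (n : ℕ) : ContDiff ℝ (⊤ : ℕ∞) (nJacobi α β c n) := by
  have : nJacobi α β c n = fun θ => (jacQ α β c n).eval (jacU θ) := funext (nJacobi_eq α β c n)
  rw [this]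
  exact ((jacQ α β c n).contDiff_aeval (𝕜 := ℝ) _).comp jacU_contDiff

lemma evalU_hasDerivAt (q : Polynomial ℝ) (θ : ℝ) :
    HasDerivAt (fun θ => q.eval (jacU θ)) ((Polynomial.derivative q).eval (jacU θ) * (-(Real.sin θ)/2)) θ :=
  (q.hasDerivAt (jacU θ)).comp θ (jacU_hasDerivAt θ)

lemma nJacobi_deriv (α β : ℝ) (c : ℕ → ℝ) (n : ℕ) :
    deriv (nJacobi α β c n) = fun θ => (Polynomial.derivative (jacQ α β c n)).eval (jacU θ) * (-(Real.sin θ)/2) := by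
  have : nJacobi α β c n = fun θ => (jacQ α β c n).eval (jacU θ) := funext (nJacobi_eq α β c n)
  rw [this]
  funext θ
  exact (evalU_hasDerivAt _ θ).deriv

lemma nJacobi_ode {α β : ℝ} (hα : -1 < α) (hβ : -1 < β) (c : ℕ → ℝ) (n : ℕ) (θ : ℝ) :
    Real.sin θ * deriv (deriv (nJacobi α β c n)) θ =
      -(jacB α β θ * deriv (nJacobi α β c n) θ) - jacLam α β n * (Real.sin θ * nJacobi α β c n θ) := by
  have h2 : deriv (deriv (nJacobi α β c n)) θ =
      (Polynomial.derivative (Polynomial.derivative (jacQ α β c n))).eval (jacU θ) * (-(Real.sin θ)/2) * (-(Real.sin θ)/2)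
      + (Polynomial.derivative (jacQ α β c n)).eval (jacU θ) * (-(Real.cos θ)/2) := by
    rw [nJacobi_deriv]
    exact ((evalU_hasDerivAt _ θ).mul (((Real.hasDerivAt_sin θ).neg).div_const 2)).deriv
  rw [h2, nJacobi_deriv, nJacobi_eq]
  have ho := jacQ_ode hα hβ c n (jacU θ)
  simp only [jacB]
  generalize (Polynomial.derivative (Polynomial.derivative (jacQ α β c n))).eval (jacU θ) = r2 at *
  generalize (Polynomial.derivative (jacQ α β c n)).eval (jacU θ) = r1 at *
  generalize (jacQ α β c n).eval (jacU θ) = r0 at *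
  have hs := Real.sin_sq_add_cos_sq θ
  unfold jacU at ho
  linear_combination (-Real.sin θ) * ho + Real.sin θ * r2 / 4 * hs

lemma jac_s_pos {θ : ℝ} (h : θ ∈ Ioo 0 π) : 0 < Real.sin (θ/2) :=
  Real.sin_pos_of_pos_of_lt_pi (by linarith [h.1]) (by linarith [h.1, h.2])

lemma jac_c_pos {θ : ℝ} (h : θ ∈ Ioo 0 π) : 0 < Real.cos (θ/2) :=
  Real.cos_pos_of_mem_Ioo ⟨by linarith [h.1, Real.pi_pos], by linarith [h.1, h.2]⟩

lemma jac_sin_half (θ : ℝ) : Real.sin θ = 2 * Real.sin (θ/2) * Real.cos (θ/2) := by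
  rw [← Real.sin_two_mul]; congr 1; ring

lemma jac_cos_half (θ : ℝ) : Real.cos θ = 2 * Real.cos (θ/2)^2 - 1 := by
  rw [← Real.cos_two_mul]; congr 1; ring

lemma jacW_pos (α β : ℝ) {θ : ℝ} (h : θ ∈ Ioo 0 π) : 0 < jacW α β θ :=
  mul_pos (Real.rpow_pos_of_pos (jac_s_pos h) _) (Real.rpow_pos_of_pos (jac_c_pos h) _)

lemma jacW_hasDerivAt (α β : ℝ) {θ : ℝ} (h : θ ∈ Ioo 0 π) :
    HasDerivAt (jacW α β) (jacW α β θ * jacB α β θ / Real.sin θ) θ := by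
  have hs := jac_s_pos h
  have hc := jac_c_pos h
  have d1 : HasDerivAt (fun θ : ℝ => Real.sin (θ/2)) (Real.cos (θ/2) * (1/2)) θ :=
    ((hasDerivAt_id' θ).div_const 2).sin
  have d2 : HasDerivAt (fun θ : ℝ => Real.cos (θ/2)) (-Real.sin (θ/2) * (1/2)) θ :=
    ((hasDerivAt_id' θ).div_const 2).cos
  have e1 := d1.rpow_const (p := 2*α+1) (Or.inl hs.ne')
  have e2 := d2.rpow_const (p := 2*β+1) (Or.inl hc.ne')
  have e := e1.mul e2
  refine e.congr_deriv ?_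
  rw [Real.rpow_sub_one hs.ne', Real.rpow_sub_one hc.ne']
  unfold jacW jacB
  rw [jac_sin_half θ, jac_cos_half θ]
  generalize (Real.sin (θ/2))^(2*α+1) = A
  generalize (Real.cos (θ/2))^(2*β+1) = B
  have hsc := Real.sin_sq_add_cos_sq (θ/2)
  field_simp
  linear_combination (-2*(1+2*β)) * A * B * hsc

lemma jacW_continuousOn (α β : ℝ) : ContinuousOn (jacW α β) (Ioo 0 π) :=
  fun _ h => (jacW_hasDerivAt α β h).continuousAt.continuousWithinAt

lemma jacWp_hasDerivAt {α β : ℝ} (hα : -1 < α) (hβ : -1 < β) (c : ℕ → ℝ) (n : ℕ) {θ : ℝ} (h : θ ∈ Ioo 0 π) :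
    HasDerivAt (fun θ => jacW α β θ * deriv (nJacobi α β c n) θ)
      (-(jacLam α β n * (jacW α β θ * nJacobi α β c n θ))) θ := by
  have h1 := jacW_hasDerivAt α β h
  have hp : ContDiff ℝ 1 (deriv (nJacobi α β c n)) :=
    ((contDiff_infty_iff_deriv.1 (nJacobi_contDiff α β c n)).2).of_le (by exact_mod_cast le_top)
  have h2 : HasDerivAt (deriv (nJacobi α β c n)) (deriv (deriv (nJacobi α β c n)) θ) θ :=
    (hp.differentiable (by norm_num) θ).hasDerivAt
  refine (h1.mul h2).congr_deriv ?_
  have hsin : 0 < Real.sin θ := Real.sin_pos_of_pos_of_lt_pi h.1 h.2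
  have ho := nJacobi_ode hα hβ c n θ
  field_simp
  linear_combination jacW α β θ * ho

/-! measure -/

lemma jacW_measurable (α β : ℝ) : Measurable (jacW α β) := by
  unfold jacW; fun_prop

lemma jacobiMeasure_eq (α β : ℝ) : jacobiMeasure α β =
    (volume.restrict (Set.Ioo 0 π)).withDensity (fun θ => ENNReal.ofReal (jacW α β θ)) := rfl

lemma jac_integral (α β : ℝ) (F : ℝ → ℝ) :
    ∫ θ, F θ ∂(jacobiMeasure α β) = ∫ θ in Ioo 0 π, jacW α β θ * F θ := by
  rw [jacobiMeasure_eq, integral_withDensity_eq_integral_toReal_smul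
    (jacW_measurable α β).ennreal_ofReal (by simp)]
  refine setIntegral_congr_fun measurableSet_Ioo fun θ hθ => ?_
  simp [ENNReal.toReal_ofReal (jacW_pos α β hθ).le]

lemma jac_integrable (α β : ℝ) (F : ℝ → ℝ) :
    Integrable F (jacobiMeasure α β) ↔ IntegrableOn (fun θ => jacW α β θ * F θ) (Ioo 0 π) := by
  rw [jacobiMeasure_eq, integrable_withDensity_iff_integrable_smul'
    (jacW_measurable α β).ennreal_ofReal (by simp)]
  refine integrable_congr ?_
  filter_upwards [ae_restrict_mem measurableSet_Ioo] with θ hθ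
  simp [ENNReal.toReal_ofReal (jacW_pos α β hθ).le]

lemma nJacobi_zero {α β : ℝ} (hα : -1 < α) (hβ : -1 < β) (c : ℕ → ℝ) (θ : ℝ) : nJacobi α β c 0 θ = c 0 := by
  have h1 := (Real.Gamma_pos_of_pos (s := α+1) (by linarith)).ne'
  have h2 := (Real.Gamma_pos_of_pos (s := β+1) (by linarith)).ne'
  simp [nJacobi, jacobiPoly, h1, h2]

lemma jac_finite {α β : ℝ} (hα : -1 < α) (hβ : -1 < β) {c : ℕ → ℝ} (hc : JacobiNormalized α β c) :
    IsFiniteMeasure (jacobiMeasure α β) := by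
  have h := hc.2 0
  have hi : Integrable (fun θ => (nJacobi α β c 0 θ)^2) (jacobiMeasure α β) := by
    by_contra hcon
    rw [integral_undef hcon] at h
    norm_num at h
  simp only [nJacobi_zero hα hβ] at hi
  rw [integrable_const_iff] at hi
  rcases hi with hi | hi
  · exact absurd hi (pow_ne_zero 2 (hc.1 0).ne')
  · exact hi

lemma evalU_bdd (q : Polynomial ℝ) : ∃ C, ∀ θ, |q.eval (jacU θ)| ≤ C := by
  obtain ⟨C, hC⟩ := (isCompact_Icc (a := (-1:ℝ)) (b := 0)).exists_bound_of_continuousOn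
    (f := fun y => q.eval y) q.continuous.continuousOn
  exact ⟨C, fun θ => hC _ ⟨by unfold jacU; linarith [Real.neg_one_le_cos θ], by unfold jacU; linarith [Real.cos_le_one θ]⟩⟩

lemma evalU_continuous (q : Polynomial ℝ) : Continuous (fun θ => q.eval (jacU θ)) :=
  q.continuous.comp jacU_contDiff.continuous

lemma evalU_integrable {α β : ℝ} [IsFiniteMeasure (jacobiMeasure α β)] (q : Polynomial ℝ) :
    Integrable (fun θ => q.eval (jacU θ)) (jacobiMeasure α β) := by
  obtain ⟨C, hC⟩ := evalU_bdd q
  exact Integrable.of_bound (evalU_continuous q).aestronglyMeasurable C (Eventually.of_forall hC)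

lemma jacLam_ne {α β : ℝ} (hα : -1 < α) (hβ : -1 < β) {n m : ℕ} (h : n ≠ m) : jacLam α β n ≠ jacLam α β m := by
  intro he
  unfold jacLam at he
  have h1 : ((n:ℝ) - m) * ((n:ℝ) + m + α + β + 1) = 0 := by linear_combination he
  rcases mul_eq_zero.1 h1 with h2 | h2
  · exact h (by exact_mod_cast sub_eq_zero.1 h2)
  · have : 1 ≤ n + m := by omega
    have : (1:ℝ) ≤ n + m := by exact_mod_cast this
    linarith

/-- orthogonality -/
lemma jac_orth {α β : ℝ} (hα : -1 < α) (hβ : -1 < β) {c : ℕ → ℝ} (hc : JacobiNormalized α β c)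
    {n m : ℕ} (h : n ≠ m) :
    ∫ θ, nJacobi α β c n θ * nJacobi α β c m θ ∂(jacobiMeasure α β) = 0 := by
  have := jac_finite hα hβ hc
  rw [jac_integral]
  set p := nJacobi α β c n with hp
  set q := nJacobi α β c m with hq
  have hint : Integrable (fun θ => p θ * q θ) (jacobiMeasure α β) := by
    have := evalU_integrable (α := α) (β := β) (jacQ α β c n * jacQ α β c m)
    simpa only [Polynomial.eval_mul, ← nJacobi_eq] using this
  rw [jac_integrable] at hint
  set V : ℝ → ℝ := fun θ => jacW α β θ * deriv p θ * q θ - jacW α β θ * deriv q θ * p θ with hV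
  have hd : ∀ θ ∈ Ioo 0 π, HasDerivAt V ((jacLam α β m - jacLam α β n) * (jacW α β θ * (p θ * q θ))) θ := by
    intro θ hθ
    have a1 := jacWp_hasDerivAt hα hβ c n hθ
    have a2 := jacWp_hasDerivAt hα hβ c m hθ
    have b1 : HasDerivAt p (deriv p θ) θ := ((nJacobi_contDiff α β c n).differentiable (by simp) θ).hasDerivAt
    have b2 : HasDerivAt q (deriv q θ) θ := ((nJacobi_contDiff α β c m).differentiable (by simp) θ).hasDerivAt
    refine ((a1.mul b2).sub (a2.mul b1)).congr_deriv ?_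
    simp only [← hp, ← hq]
    ring
  set G : ℝ → ℝ := fun θ => -((Real.sin (θ/2))^(2*α+2) * (Real.cos (θ/2))^(2*β+2) *
    ((Polynomial.derivative (jacQ α β c n)).eval (jacU θ) * q θ -
     (Polynomial.derivative (jacQ α β c m)).eval (jacU θ) * p θ)) with hG
  have hGc : Continuous G := by
    have c1 := evalU_continuous (Polynomial.derivative (jacQ α β c n))
    have c2 := evalU_continuous (Polynomial.derivative (jacQ α β c m))
    have c3 : Continuous p := (nJacobi_contDiff α β c n).continuous
    have c4 : Continuous q := (nJacobi_contDiff α β c m).continuous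
    have c5 : Continuous fun θ : ℝ => (Real.sin (θ/2))^(2*α+2) :=
      (by fun_prop : Continuous fun θ : ℝ => Real.sin (θ/2)).rpow_const (fun _ => Or.inr (by linarith))
    have c6 : Continuous fun θ : ℝ => (Real.cos (θ/2))^(2*β+2) :=
      (by fun_prop : Continuous fun θ : ℝ => Real.cos (θ/2)).rpow_const (fun _ => Or.inr (by linarith))
    exact ((c5.mul c6).mul ((c1.mul c4).sub (c2.mul c3))).neg
  have hVG : ∀ θ ∈ Ioo 0 π, G θ = V θ := by
    intro θ hθ
    have e1 : (Real.sin (θ/2))^(2*α+2) = (Real.sin (θ/2))^(2*α+1) * Real.sin (θ/2) := by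
      rw [← Real.rpow_add_one (jac_s_pos hθ).ne']; ring_nf
    have e2 : (Real.cos (θ/2))^(2*β+2) = (Real.cos (θ/2))^(2*β+1) * Real.cos (θ/2) := by
      rw [← Real.rpow_add_one (jac_c_pos hθ).ne']; ring_nf
    simp only [hG, hV, e1, e2, hp, hq, nJacobi_deriv, jacW, jac_sin_half θ]
    ring
  have G0 : G 0 = 0 := by simp [hG, Real.zero_rpow (show 2*α+2 ≠ 0 by linarith)]
  have Gpi : G π = 0 := by simp [hG, Real.zero_rpow (show 2*β+2 ≠ 0 by linarith)]
  have hint2 : IntervalIntegrable (fun θ => (jacLam α β m - jacLam α β n) * (jacW α β θ * (p θ * q θ))) volume 0 π := by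
    rw [intervalIntegrable_iff_integrableOn_Ioo_of_le Real.pi_pos.le]
    exact hint.const_mul _
  have key := intervalIntegral.integral_eq_sub_of_hasDerivAt_of_le Real.pi_pos.le hGc.continuousOn
    (f' := fun θ => (jacLam α β m - jacLam α β n) * (jacW α β θ * (p θ * q θ))) (fun θ hθ =>
      (hd θ hθ).congr_of_eventuallyEq (by
        filter_upwards [Ioo_mem_nhds hθ.1 hθ.2] with x hx using hVG x hx)) hint2
  rw [G0, Gpi, intervalIntegral.integral_const_mul, intervalIntegral.integral_of_le Real.pi_pos.le,
    integral_Ioc_eq_integral_Ioo, sub_zero] at key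
  rcases mul_eq_zero.1 key with h1 | h1
  · exact absurd (sub_eq_zero.1 h1) (jacLam_ne hα hβ h.symm)
  · exact h1



/-! ### Part 3: recurrence -/

lemma jac_span {Q : ℕ → Polynomial ℝ} (hd : ∀ n, (Q n).natDegree ≤ n) (hl : ∀ n, (Q n).coeff n ≠ 0) (m : ℕ) :
    ∀ q : Polynomial ℝ, q.natDegree ≤ m →
      ∃ d : ℕ → ℝ, q = ∑ i ∈ Finset.range (m+1), Polynomial.C (d i) * Q i := by
  induction m with
  | zero =>
    intro q hq
    refine ⟨fun _ => q.coeff 0 / (Q 0).coeff 0, ?_⟩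
    have h1 := Polynomial.eq_C_of_natDegree_le_zero hq
    have h2 := Polynomial.eq_C_of_natDegree_le_zero (hd 0)
    rw [Finset.sum_range_one]
    conv_rhs => rw [h2]
    rw [← Polynomial.C_mul, Polynomial.coeff_C_zero, div_mul_cancel₀ _ (hl 0)]
    exact h1
  | succ m ih =>
    intro q hq
    set e := q.coeff (m+1) / (Q (m+1)).coeff (m+1) with he
    have h1 : (q - Polynomial.C e * Q (m+1)).natDegree ≤ m := by
      rw [Polynomial.natDegree_le_iff_coeff_eq_zero]
      intro k hk
      rw [Polynomial.coeff_sub, Polynomial.coeff_C_mul]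
      rcases Nat.lt_or_ge (m+1) k with h | h
      · rw [Polynomial.coeff_eq_zero_of_natDegree_lt (lt_of_le_of_lt hq h),
          Polynomial.coeff_eq_zero_of_natDegree_lt (lt_of_le_of_lt (hd _) h)]
        simp
      · have : k = m+1 := by omega
        subst this
        rw [he, div_mul_cancel₀ _ (hl _), sub_self]
    obtain ⟨d, hd'⟩ := ih _ h1
    refine ⟨fun i => if i = m+1 then e else d i, ?_⟩
    beta_reduce
    rw [Finset.sum_range_succ, if_pos rfl]
    have : ∑ i ∈ Finset.range (m+1), Polynomial.C (if i = m+1 then e else d i) * Q i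
        = ∑ i ∈ Finset.range (m+1), Polynomial.C (d i) * Q i :=
      Finset.sum_congr rfl fun i hi => by
        rw [if_neg (by have := Finset.mem_range.1 hi; omega)]
    rw [this, ← hd']; ring

lemma jac_recurrence_abs {Q : ℕ → Polynomial ℝ} (hd : ∀ n, (Q n).natDegree ≤ n) (hl : ∀ n, (Q n).coeff n ≠ 0)
    (L : Polynomial ℝ →ₗ[ℝ] ℝ) (hL : ∀ n m, L (Q n * Q m) = if n = m then 1 else 0) :
    (Polynomial.X * Q 0 = Polynomial.C (L (Polynomial.X * Q 0 * Q 1)) * Q 1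
        + Polynomial.C (L (Polynomial.X * Q 0 * Q 0)) * Q 0) ∧
    ∀ n, Polynomial.X * Q (n+1) = Polynomial.C (L (Polynomial.X * Q (n+1) * Q (n+2))) * Q (n+2)
        + Polynomial.C (L (Polynomial.X * Q (n+1) * Q (n+1))) * Q (n+1)
        + Polynomial.C (L (Polynomial.X * Q n * Q (n+1))) * Q n := by
  have hdeg : ∀ n, (Polynomial.X * Q n).natDegree ≤ n+1 := fun n =>
    Polynomial.natDegree_mul_le.trans (by
      have := hd n
      rw [Polynomial.natDegree_X]; omega)
  have hexp : ∀ (m : ℕ) (q : Polynomial ℝ), q.natDegree ≤ m →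
      (q = ∑ i ∈ Finset.range (m+1), Polynomial.C (L (q * Q i)) * Q i) ∧ ∀ k, m < k → L (q * Q k) = 0 := by
    intro m q hq
    obtain ⟨d, hd'⟩ := jac_span hd hl m q hq
    have hk : ∀ k, L (q * Q k) = ∑ i ∈ Finset.range (m+1), d i * (if i = k then 1 else 0) := by
      intro k
      conv_lhs => rw [hd']
      rw [Finset.sum_mul, map_sum]
      refine Finset.sum_congr rfl fun i _ => ?_
      rw [mul_assoc, ← Polynomial.smul_eq_C_mul, map_smul, hL, smul_eq_mul]
    constructor
    · conv_lhs => rw [hd']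
      refine Finset.sum_congr rfl fun i hi => ?_
      rw [hk i]
      congr 2
      simp only [mul_ite, mul_one, mul_zero]
      rw [Finset.sum_ite_eq' , if_pos hi]
    · intro k hk'
      rw [hk k]
      refine Finset.sum_eq_zero fun i hi => ?_
      have := Finset.mem_range.1 hi
      rw [if_neg (by omega), mul_zero]
  constructor
  · have := (hexp 1 _ (hdeg 0)).1
    conv_lhs => rw [this]
    simp [Finset.sum_range_succ]
    ring
  · intro n
    have := (hexp (n+2) _ (hdeg (n+1))).1
    conv_lhs => rw [this]
    rw [Finset.sum_range_succ, Finset.sum_range_succ, Finset.sum_range_succ, Finset.sum_eq_zero]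
    · have e : L (Polynomial.X * Q (n+1) * Q n) = L (Polynomial.X * Q n * Q (n+1)) := by
        congr 1; ring
      rw [e]; ring
    · intro i hi
      have hi' := Finset.mem_range.1 hi
      have e : L (Polynomial.X * Q (n+1) * Q i) = L (Polynomial.X * Q i * Q (n+1)) := by
        congr 1; ring
      rw [e, (hexp (i+1) _ (hdeg i)).2 (n+1) (by omega)]
      simp

lemma jac_recurrence {α β : ℝ} (hα : -1 < α) (hβ : -1 < β) {c : ℕ → ℝ} (hc : JacobiNormalized α β c) :
    ∃ a : ℕ → ℝ, (∀ n, |a n| ≤ 1) ∧ ∀ n θ φ,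
      (jacU θ - jacU φ) * nJacobi α β c (n+1) θ * nJacobi α β c (n+1) φ =
        a (n+1) * (nJacobi α β c (n+2) θ * nJacobi α β c (n+1) φ
          - nJacobi α β c (n+1) θ * nJacobi α β c (n+2) φ)
        - a n * (nJacobi α β c (n+1) θ * nJacobi α β c n φ
          - nJacobi α β c n θ * nJacobi α β c (n+1) φ) := by
  have := jac_finite hα hβ hc
  set Q := jacQ α β c with hQ
  have hd : ∀ n, (Q n).natDegree ≤ n := fun n =>
    (Polynomial.natDegree_C_mul_le _ _).trans (jacR_degree_le α β n)
  have hl : ∀ n, (Q n).coeff n ≠ 0 := fun n => by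
    simp only [hQ, jacQ, Polynomial.coeff_C_mul]
    exact (mul_pos (hc.1 n) (jacR_coeff_pos hα hβ n)).ne'
  let L : Polynomial ℝ →ₗ[ℝ] ℝ :=
    { toFun := fun q => ∫ θ, q.eval (jacU θ) ∂(jacobiMeasure α β)
      map_add' := fun p q => by
        simp only [Polynomial.eval_add]
        exact integral_add (evalU_integrable p) (evalU_integrable q)
      map_smul' := fun r q => by
        simp only [Polynomial.eval_smul, smul_eq_mul, RingHom.id_apply]
        exact integral_const_mul _ _ }
  have hLdef : ∀ q, L q = ∫ θ, q.eval (jacU θ) ∂(jacobiMeasure α β) := fun q => rfl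
  have hsq : ∀ n, L (Q n * Q n) = 1 := fun n => by
    rw [hLdef, ← hc.2 n]
    congr 1; funext θ
    rw [Polynomial.eval_mul, nJacobi_eq, sq]
  have hL : ∀ n m, L (Q n * Q m) = if n = m then 1 else 0 := by
    intro n m
    split_ifs with h
    · subst h; exact hsq n
    · rw [hLdef, ← jac_orth hα hβ hc h]
      congr 1; funext θ
      rw [Polynomial.eval_mul, nJacobi_eq, nJacobi_eq]
  obtain ⟨-, h1⟩ := jac_recurrence_abs hd hl L hL
  refine ⟨fun n => L (Polynomial.X * Q n * Q (n+1)), fun n => ?_, fun n θ φ => ?_⟩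
  · have hb : ∀ θ, ‖(Polynomial.X * Q n * Q (n+1)).eval (jacU θ)‖ ≤
        ((1/2 : ℝ) • (Q n * Q n + Q (n+1) * Q (n+1))).eval (jacU θ) := by
      intro θ
      simp only [Polynomial.eval_mul, Polynomial.eval_X, Polynomial.eval_smul, Polynomial.eval_add, smul_eq_mul]
      generalize (Q n).eval (jacU θ) = x
      generalize (Q (n+1)).eval (jacU θ) = y
      have hu : |jacU θ| ≤ 1 := by
        unfold jacU
        rw [abs_le]; constructor <;> linarith [Real.neg_one_le_cos θ, Real.cos_le_one θ]
      rw [Real.norm_eq_abs, mul_assoc, abs_mul]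
      have hxy : |x * y| ≤ 1/2 * (x*x+y*y) := by
        rw [abs_le]; constructor <;> nlinarith [sq_nonneg (x-y), sq_nonneg (x+y)]
      calc |jacU θ| * |x*y| ≤ 1 * |x*y| := by gcongr
        _ ≤ _ := by linarith
    have := norm_integral_le_of_norm_le (evalU_integrable (α := α) (β := β) ((1/2 : ℝ) • (Q n * Q n + Q (n+1) * Q (n+1))))
      (Eventually.of_forall hb)
    rw [← hLdef, ← hLdef, map_smul, map_add, hsq, hsq] at this
    rw [Real.norm_eq_abs] at this
    refine this.trans ?_
    norm_num
  · have hx := congrArg (fun q => Polynomial.eval (jacU θ) q) (h1 n)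
    have hy := congrArg (fun q => Polynomial.eval (jacU φ) q) (h1 n)
    simp only [Polynomial.eval_add, Polynomial.eval_mul, Polynomial.eval_X, Polynomial.eval_C] at hx hy
    simp only [nJacobi_eq]
    simp only [← hQ]
    linear_combination ((Q (n+1)).eval (jacU φ)) * hx - ((Q (n+1)).eval (jacU θ)) * hy



/-! ### Part 4: polynomial growth bounds -/

def JBd (a b : ℝ) (d : ℕ) (g : ℕ → ℝ → ℝ) : Prop :=
  ∃ C, 0 ≤ C ∧ ∀ n : ℕ, ∀ x ∈ Icc a b, |g n x| ≤ C * ((n:ℝ)+1)^d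

lemma JBd.mono {a b : ℝ} {d d' : ℕ} {g : ℕ → ℝ → ℝ} (h : JBd a b d g) (hd : d ≤ d') : JBd a b d' g := by
  obtain ⟨C, hC, h⟩ := h
  refine ⟨C, hC, fun n x hx => (h n x hx).trans ?_⟩
  have : (1:ℝ) ≤ (n:ℝ)+1 := by linarith [(Nat.cast_nonneg n : (0:ℝ) ≤ n)]
  gcongr

lemma JBd.add {a b : ℝ} {d : ℕ} {g g' : ℕ → ℝ → ℝ} (h : JBd a b d g) (h' : JBd a b d g') :
    JBd a b d (fun n x => g n x + g' n x) := by
  obtain ⟨C, hC, h⟩ := h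
  obtain ⟨C', hC', h'⟩ := h'
  refine ⟨C + C', by positivity, fun n x hx => (abs_add_le _ _).trans ?_⟩
  rw [add_mul]
  exact add_le_add (h n x hx) (h' n x hx)

lemma JBd.neg {a b : ℝ} {d : ℕ} {g : ℕ → ℝ → ℝ} (h : JBd a b d g) :
    JBd a b d (fun n x => - g n x) := by
  obtain ⟨C, hC, h⟩ := h
  exact ⟨C, hC, fun n x hx => by rw [abs_neg]; exact h n x hx⟩

lemma JBd.sub {a b : ℝ} {d : ℕ} {g g' : ℕ → ℝ → ℝ} (h : JBd a b d g) (h' : JBd a b d g') :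
    JBd a b d (fun n x => g n x - g' n x) := by
  simpa only [sub_eq_add_neg] using h.add h'.neg

lemma JBd.mul {a b : ℝ} {d d' : ℕ} {g g' : ℕ → ℝ → ℝ} (h : JBd a b d g) (h' : JBd a b d' g') :
    JBd a b (d + d') (fun n x => g n x * g' n x) := by
  obtain ⟨C, hC, h⟩ := h
  obtain ⟨C', hC', h'⟩ := h'
  refine ⟨C * C', by positivity, fun n x hx => ?_⟩
  rw [abs_mul]
  calc |g n x| * |g' n x| ≤ (C * ((n:ℝ)+1)^d) * (C' * ((n:ℝ)+1)^d') :=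
        mul_le_mul (h n x hx) (h' n x hx) (abs_nonneg _) (by positivity)
    _ = _ := by ring

lemma JBd.of_cont {a b : ℝ} {h : ℝ → ℝ} (hh : ContinuousOn h (Icc a b)) : JBd a b 0 (fun _ => h) := by
  obtain ⟨C, hC⟩ := isCompact_Icc.exists_bound_of_continuousOn hh
  exact ⟨max C 0, le_max_right _ _, fun n x hx => by
    have := (hC x hx).trans (le_max_left C 0)
    rw [Real.norm_eq_abs] at this
    simpa only [pow_zero, mul_one] using this⟩

lemma JBd.sum {a b : ℝ} {d : ℕ} {s : Finset ℕ} {g : ℕ → ℕ → ℝ → ℝ} (h : ∀ i ∈ s, JBd a b d (g i)) :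
    JBd a b d (fun n x => ∑ i ∈ s, g i n x) := by
  induction s using Finset.induction_on with
  | empty => exact ⟨0, le_rfl, by simp⟩
  | insert i s hi ih =>
    have h1 := (h i (by simp)).add (ih fun k hk => h k (by simp [hk]))
    simpa only [Finset.sum_insert hi] using h1

lemma iteratedDeriv_cont {h : ℝ → ℝ} (hh : ContDiff ℝ (⊤ : ℕ∞) h) (i : ℕ) : Continuous (iteratedDeriv i h) :=
  hh.continuous_iteratedDeriv i (by exact_mod_cast le_top)

lemma JBd_leib_rem {a b : ℝ} {h : ℝ → ℝ} (hh : ContDiff ℝ (⊤ : ℕ∞) h) {g : ℕ → ℝ → ℝ}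
    (hg : ∀ n, ContDiff ℝ (⊤ : ℕ∞) (g n)) (e k : ℕ)
    (hb : ∀ i < k, JBd a b (e+i) (fun n => iteratedDeriv i (g n))) :
    JBd a b (e+(k-1)) (fun n x => iteratedDeriv k (fun x => h x * g n x) x - h x * iteratedDeriv k (g n) x) := by
  have heq : (fun (n:ℕ) x => iteratedDeriv k (fun x => h x * g n x) x - h x * iteratedDeriv k (g n) x) =
      fun (n:ℕ) x => ∑ i ∈ Finset.range k, (k.choose (i+1) : ℝ) * iteratedDeriv (i+1) h x * iteratedDeriv (k-(i+1)) (g n) x := by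
    funext n x
    have := iteratedDeriv_mul (n := k) (x := x) (f := h) (g := g n)
      (hh.of_le (by exact_mod_cast le_top)).contDiffAt ((hg n).of_le (by exact_mod_cast le_top)).contDiffAt
    have h2 : (fun x => h x * g n x) = h * g n := rfl
    rw [h2, this, Finset.sum_range_succ']
    simp
  rw [heq]
  refine JBd.sum fun i hi => ?_
  have hi' := Finset.mem_range.1 hi
  have h1 : JBd a b 0 (fun _ x => (k.choose (i+1) : ℝ) * iteratedDeriv (i+1) h x) :=
    JBd.of_cont (continuous_const.mul (iteratedDeriv_cont hh (i+1))).continuousOn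
  exact (h1.mul (hb (k-(i+1)) (by omega))).mono (by omega)

lemma JBd_leib {a b : ℝ} {h : ℝ → ℝ} (hh : ContDiff ℝ (⊤ : ℕ∞) h) {g : ℕ → ℝ → ℝ}
    (hg : ∀ n, ContDiff ℝ (⊤ : ℕ∞) (g n)) (e k : ℕ)
    (hb : ∀ i ≤ k, JBd a b (e+i) (fun n => iteratedDeriv i (g n))) :
    JBd a b (e+k) (fun n => iteratedDeriv k (fun x => h x * g n x)) := by
  have h1 := (JBd_leib_rem hh hg e k fun i hi => hb i hi.le).mono (d' := e+k) (by omega)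
  have h2 := ((JBd.of_cont (a := a) (b := b) hh.continuous.continuousOn).mul (hb k le_rfl)).mono (d' := e+k) (by omega)
  simpa using h1.add h2

lemma jacLam_bd (α β : ℝ) : ∃ C, 0 ≤ C ∧ ∀ n, |jacLam α β n| ≤ C * ((n:ℝ)+1)^2 := by
  refine ⟨1 + |α+β+1|, by positivity, fun n => ?_⟩
  have hn : (0:ℝ) ≤ n := Nat.cast_nonneg n
  unfold jacLam
  rw [abs_mul, abs_of_nonneg hn]
  have h1 : |(n:ℝ)+α+β+1| ≤ n + |α+β+1| := by
    calc |(n:ℝ)+α+β+1| = |(n:ℝ) + (α+β+1)| := by ring_nf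
      _ ≤ |(n:ℝ)| + |α+β+1| := abs_add_le _ _
      _ = _ := by rw [abs_of_nonneg hn]
  have h2 := abs_nonneg (α+β+1)
  calc (n:ℝ) * |(n:ℝ)+α+β+1| ≤ n * (n + |α+β+1|) := by gcongr
    _ ≤ _ := by nlinarith [mul_nonneg hn h2, mul_nonneg (mul_nonneg hn hn) h2]

/-- higher derivative bounds from the ODE -/
lemma jac_bounds_of_low {α β : ℝ} (hα : -1 < α) (hβ : -1 < β) (c : ℕ → ℝ) {a b : ℝ} (ha : 0 < a) (hb : b < π)
    (h0 : JBd a b 0 (nJacobi α β c)) (h1 : JBd a b 1 (fun n => deriv (nJacobi α β c n))) (k : ℕ) :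
    JBd a b k (fun n => iteratedDeriv k (nJacobi α β c n)) := by
  induction k using Nat.strong_induction_on with
  | _ k ih =>
    rcases k with _ | _ | k
    · simpa using h0
    · simpa using h1
    · have hp := nJacobi_contDiff α β c
      have hp1 : ∀ n, ContDiff ℝ (⊤ : ℕ∞) (deriv (nJacobi α β c n)) := fun n =>
        (contDiff_infty_iff_deriv.1 (hp n)).2
      have hp2 : ∀ n, ContDiff ℝ (⊤ : ℕ∞) (deriv (deriv (nJacobi α β c n))) := fun n =>
        (contDiff_infty_iff_deriv.1 (hp1 n)).2
      have hsin : ContDiff ℝ (⊤ : ℕ∞) Real.sin := Real.contDiff_sin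
      have r1 : JBd a b (k+1) (fun n => iteratedDeriv k (fun x => jacB α β x * deriv (nJacobi α β c n) x)) := by
        refine (JBd_leib (jacB_contDiff α β) hp1 1 k fun i hi => ?_).mono (by omega)
        have := ih (i+1) (by omega)
        simp only [iteratedDeriv_succ'] at this
        exact this.mono (by omega)
      have r2 : JBd a b k (fun n => iteratedDeriv k (fun x => Real.sin x * nJacobi α β c n x)) := by
        refine (JBd_leib hsin hp 0 k fun i hi => ?_).mono (by omega)
        exact (ih i (by omega)).mono (by omega)
      have r3 : JBd a b (2+(k-1)) (fun n x => iteratedDeriv k (fun x => Real.sin x * deriv (deriv (nJacobi α β c n)) x) x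
          - Real.sin x * iteratedDeriv k (deriv (deriv (nJacobi α β c n))) x) := by
        refine JBd_leib_rem hsin hp2 2 k fun i hi => ?_
        have := ih (i+2) (by omega)
        simp only [iteratedDeriv_succ'] at this
        exact this.mono (by omega)
      obtain ⟨CL, hCL, hL⟩ := jacLam_bd α β
      have r4 : JBd a b 2 (fun n _ => jacLam α β n) := ⟨CL, hCL, fun n _ _ => hL n⟩
      have r5 : JBd a b (k+2) (fun n x => Real.sin x * iteratedDeriv (k+2) (nJacobi α β c n) x) := by
        have hh := ((r1.mono (d' := k+2) (by omega)).neg.sub ((r4.mul r2).mono (d' := k+2) (by omega))).sub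
          (r3.mono (d' := k+2) (by omega))
        refine cast ?_ hh
        congr 1
        funext n x
        have e1 : (fun x => Real.sin x * deriv (deriv (nJacobi α β c n)) x) =
          fun x => -(jacB α β x * deriv (nJacobi α β c n) x) - jacLam α β n * (Real.sin x * nJacobi α β c n x) :=
          funext (nJacobi_ode hα hβ c n)
        have s1 : ContDiff ℝ (k:ℕ∞) fun x => jacB α β x * deriv (nJacobi α β c n) x :=
          ((jacB_contDiff α β).mul (hp1 n)).of_le (by exact_mod_cast le_top)
        have s2 : ContDiff ℝ (k:ℕ∞) fun x => Real.sin x * nJacobi α β c n x :=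
          (hsin.mul (hp n)).of_le (by exact_mod_cast le_top)
        have e2 : iteratedDeriv k (fun x => Real.sin x * deriv (deriv (nJacobi α β c n)) x) x =
            -(iteratedDeriv k (fun x => jacB α β x * deriv (nJacobi α β c n) x) x)
            - jacLam α β n * iteratedDeriv k (fun x => Real.sin x * nJacobi α β c n x) x := by
          rw [e1, iteratedDeriv_fun_sub s1.neg.contDiffAt (contDiff_const.mul s2).contDiffAt,
            iteratedDeriv_fun_neg, iteratedDeriv_const_mul_field]
        rw [e2, iteratedDeriv_succ', iteratedDeriv_succ']
        ring
      have hinv : JBd a b 0 (fun _ x => (Real.sin x)⁻¹) := by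
        refine JBd.of_cont (Real.continuous_sin.continuousOn.inv₀ fun x hx => ?_)
        exact (Real.sin_pos_of_pos_of_lt_pi (by linarith [hx.1]) (by linarith [hx.2])).ne'
      obtain ⟨C, hC, hfin⟩ := hinv.mul r5
      refine ⟨C, hC, fun n x hx => ?_⟩
      have hs : Real.sin x ≠ 0 :=
        (Real.sin_pos_of_pos_of_lt_pi (by linarith [hx.1]) (by linarith [hx.2])).ne'
      have := hfin n x hx
      beta_reduce at this
      rwa [inv_mul_cancel_left₀ hs, zero_add] at this



/-! ### Part 5: energy estimates -/

lemma energy_compare {a b M L : ℝ} (hM : 0 ≤ M) (hL : 0 ≤ L) {p p1 p2 q : ℝ → ℝ}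
    (h0 : ∀ x, HasDerivAt p (p1 x) x) (h1 : ∀ x, HasDerivAt p1 (p2 x) x)
    (hq : ∀ x ∈ Icc a b, |q x| ≤ M) (hode : ∀ x ∈ Icc a b, p2 x = -(q x * p1 x) - L * p x)
    {x y : ℝ} (hx : x ∈ Icc a b) (hy : y ∈ Icc a b) :
    p1 x ^ 2 + L * p x ^ 2 ≤ Real.exp (2 * M * (b - a)) * (p1 y ^ 2 + L * p y ^ 2) := by
  have hE : ∀ x, HasDerivAt (fun x => p1 x ^ 2 + L * p x ^ 2) (2 * p1 x * p2 x + L * (2 * p x * p1 x)) x := by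
    intro x
    have e1 := (h1 x).pow 2
    have e2 := ((h0 x).pow 2).const_mul L
    refine (e1.add e2).congr_deriv ?_
    norm_num
  have hexp : ∀ s x : ℝ, HasDerivAt (fun x => Real.exp (s * x)) (Real.exp (s*x) * s) x := by
    intro s x
    have := ((hasDerivAt_id x).const_mul s).exp
    simpa using this
  have hF : ∀ s x, HasDerivAt (fun x => Real.exp (s * x) * (p1 x ^ 2 + L * p x ^ 2))
      (Real.exp (s*x) * s * (p1 x ^ 2 + L * p x ^ 2) + Real.exp (s*x) * (2 * p1 x * p2 x + L * (2 * p x * p1 x))) x :=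
    fun s x => (hexp s x).mul (hE x)
  have hEn : ∀ x, 0 ≤ p1 x ^ 2 + L * p x ^ 2 := fun x => by positivity
  have key : ∀ x ∈ Icc a b, |2 * p1 x * p2 x + L * (2 * p x * p1 x)| ≤ 2 * M * (p1 x ^ 2 + L * p x ^ 2) := by
    intro x hx
    rw [hode x hx]
    have : 2 * p1 x * (-(q x * p1 x) - L * p x) + L * (2 * p x * p1 x) = -(2 * q x * p1 x ^ 2) := by ring
    rw [this, abs_neg, abs_mul, abs_mul, abs_two, abs_of_nonneg (sq_nonneg (p1 x))]
    have h3 := hq x hx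
    have h4 : 0 ≤ L * p x ^ 2 := by positivity
    nlinarith [mul_nonneg hM h4, mul_le_mul_of_nonneg_right h3 (sq_nonneg (p1 x))]
  have mono : MonotoneOn (fun x => Real.exp (2*M * x) * (p1 x ^ 2 + L * p x ^ 2)) (Icc a b) := by
    refine monotoneOn_of_deriv_nonneg (convex_Icc a b) (fun x _ => (hF _ x).continuousAt.continuousWithinAt)
      (fun x _ => (hF _ x).differentiableAt.differentiableWithinAt) fun x hx => ?_
    rw [(hF _ x).deriv]
    have := (abs_le.1 (key x (interior_subset hx))).1
    have he := Real.exp_pos (2*M*x)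
    nlinarith
  have anti : AntitoneOn (fun x => Real.exp (-(2*M) * x) * (p1 x ^ 2 + L * p x ^ 2)) (Icc a b) := by
    refine antitoneOn_of_deriv_nonpos (convex_Icc a b) (fun x _ => (hF _ x).continuousAt.continuousWithinAt)
      (fun x _ => (hF _ x).differentiableAt.differentiableWithinAt) fun x hx => ?_
    rw [(hF _ x).deriv]
    have := (abs_le.1 (key x (interior_subset hx))).2
    have he := Real.exp_pos (-(2*M)*x)
    nlinarith
  rcases le_total x y with hxy | hxy
  · have := mono hx hy hxy
    beta_reduce at this
    have h5 : Real.exp (2*M*y) ≤ Real.exp (2*M*x) * Real.exp (2*M*(b-a)) := by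
      rw [← Real.exp_add]
      apply Real.exp_le_exp.2
      have h6 : y - x ≤ b - a := by linarith [hx.1, hy.2]
      nlinarith
    have h7 : Real.exp (2*M*x) * (p1 x ^ 2 + L * p x ^ 2) ≤ Real.exp (2*M*x) * (Real.exp (2*M*(b-a)) * (p1 y ^ 2 + L * p y ^ 2)) := by
      rw [← mul_assoc]
      exact this.trans (mul_le_mul_of_nonneg_right h5 (hEn y))
    exact le_of_mul_le_mul_left h7 (Real.exp_pos _)
  · have := anti hy hx hxy
    beta_reduce at this
    have h5 : Real.exp (-(2*M)*y) ≤ Real.exp (-(2*M)*x) * Real.exp (2*M*(b-a)) := by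
      rw [← Real.exp_add]
      apply Real.exp_le_exp.2
      have h6 : x - y ≤ b - a := by linarith [hx.2, hy.1]
      nlinarith
    have h7 : Real.exp (-(2*M)*x) * (p1 x ^ 2 + L * p x ^ 2) ≤ Real.exp (-(2*M)*x) * (Real.exp (2*M*(b-a)) * (p1 y ^ 2 + L * p y ^ 2)) := by
      rw [← mul_assoc]
      exact this.trans (mul_le_mul_of_nonneg_right h5 (hEn y))
    exact le_of_mul_le_mul_left h7 (Real.exp_pos _)

lemma energy_int {a b L : ℝ} (hab : a < b) (hL : 0 ≤ L) {p p1 w : ℝ → ℝ}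
    (h0 : ∀ x, HasDerivAt p (p1 x) x) (hp1 : Continuous p1)
    (hw : ContinuousOn w (Icc a b)) (hwpos : ∀ x ∈ Icc a b, 0 < w x)
    (hwp : ∀ x ∈ Icc a b, HasDerivAt (fun x => w x * p1 x) (-(L * (w x * p x))) x)
    (hnorm : ∫ x in a..b, w x * p x ^ 2 ≤ 1) :
    ∫ x in a..b, ((x-a)*(b-x))^2 * w x * (p1 x ^ 2 + L * p x ^ 2) ≤ 3 * L * (b-a)^4 + 4 * (b-a)^2 := by
  have hp : Continuous p := continuous_iff_continuousAt.2 fun x => (h0 x).continuousAt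
  set g' : ℝ → ℝ := fun x => (2 * ((x-a)*(b-x)) * (b - x - (x - a)) * (w x * p1 x) + ((x-a)*(b-x))^2 * (-(L * (w x * p x)))) * p x
      + ((x-a)*(b-x))^2 * (w x * p1 x) * p1 x with hg'
  have hG : ∀ x ∈ Icc a b, HasDerivAt (fun x => ((x-a)*(b-x))^2 * (w x * p1 x) * p x) (g' x) x := by
    intro x hx
    have e1 : HasDerivAt (fun x : ℝ => ((x-a)*(b-x))^2) (2 * ((x-a)*(b-x)) * (b - x - (x - a))) x := by
      have := (((hasDerivAt_id x).sub_const a).mul ((hasDerivAt_id x).const_sub b)).pow 2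
      refine this.congr_deriv ?_
      simp only [id, Pi.mul_apply]
      push_cast
      ring
    exact (e1.mul (hwp x hx)).mul (h0 x)
  have hcont : ContinuousOn g' (Icc a b) := by
    simp only [hg']
    fun_prop
  have hint : ∫ x in a..b, g' x = 0 := by
    rw [intervalIntegral.integral_eq_sub_of_hasDerivAt_of_le hab.le (fun x hx => (hG x hx).continuousAt.continuousWithinAt)
      (fun x hx => hG x (Ioo_subset_Icc_self hx)) (hcont.intervalIntegrable_of_Icc hab.le)]
    simp
  have hc2 : ContinuousOn (fun x => w x * p x ^ 2) (Icc a b) := by fun_prop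
  have hc3 : ContinuousOn (fun x => ((x-a)*(b-x))^2 * w x * (p1 x ^ 2 + L * p x ^ 2)) (Icc a b) := by fun_prop
  have hle : ∫ x in a..b, ((x-a)*(b-x))^2 * w x * (p1 x ^ 2 + L * p x ^ 2) ≤
      ∫ x in a..b, (2 * g' x + (3 * L * (b-a)^4 + 4 * (b-a)^2) * (w x * p x ^ 2)) := by
    refine intervalIntegral.integral_mono_on hab.le (hc3.intervalIntegrable_of_Icc hab.le)
      (((hcont.intervalIntegrable_of_Icc hab.le).const_mul 2).add ((hc2.intervalIntegrable_of_Icc hab.le).const_mul _)) fun x hx => ?_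
    have w0 := hwpos x hx
    have k1 : ((x-a)*(b-x))^2 ≤ (b-a)^4 := by
      have : (x-a)*(b-x) ≤ (b-a)^2 := by nlinarith [hx.1, hx.2]
      have h' : 0 ≤ (x-a)*(b-x) := mul_nonneg (by linarith [hx.1]) (by linarith [hx.2])
      calc _ ≤ ((b-a)^2)^2 := by gcongr
        _ = _ := by ring
    have k2 : (b - x - (x - a))^2 ≤ (b-a)^2 := by nlinarith [hx.1, hx.2]
    have k3 : 0 ≤ w x * (((x-a)*(b-x)) * p1 x + 2 * (b - x - (x-a)) * p x)^2 := by positivity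
    have k4 : 0 ≤ w x * p x ^2 := by positivity
    have k5 : 0 ≤ (3 * L * ((b-a)^4 - ((x-a)*(b-x))^2)) * (w x * p x ^2) :=
      mul_nonneg (mul_nonneg (by positivity) (by linarith)) k4
    have k6 : 0 ≤ (4 * ((b-a)^2 - (b - x - (x - a))^2)) * (w x * p x ^2) :=
      mul_nonneg (mul_nonneg (by positivity) (by linarith)) k4
    simp only [hg']
    linear_combination k3 + k5 + k6
  rw [intervalIntegral.integral_add ((hcont.intervalIntegrable_of_Icc hab.le).const_mul 2) ((hc2.intervalIntegrable_of_Icc hab.le).const_mul _),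
    intervalIntegral.integral_const_mul, intervalIntegral.integral_const_mul, hint, mul_zero, zero_add] at hle
  have : 0 ≤ 3 * L * (b-a)^4 + 4 * (b-a)^2 := by positivity
  nlinarith

lemma energy_final {a b M L : ℝ} (hab : a < b) (hM : 0 ≤ M) (hL : 0 ≤ L) {p p1 p2 q w : ℝ → ℝ}
    (h0 : ∀ x, HasDerivAt p (p1 x) x) (h1 : ∀ x, HasDerivAt p1 (p2 x) x)
    (hq : ∀ x ∈ Icc a b, |q x| ≤ M) (hode : ∀ x ∈ Icc a b, p2 x = -(q x * p1 x) - L * p x)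
    (hw : ContinuousOn w (Icc a b)) (hwpos : ∀ x ∈ Icc a b, 0 < w x)
    (hwp : ∀ x ∈ Icc a b, HasDerivAt (fun x => w x * p1 x) (-(L * (w x * p x))) x)
    (hnorm : ∫ x in a..b, w x * p x ^ 2 ≤ 1) {x : ℝ} (hx : x ∈ Icc a b) :
    (p1 x ^ 2 + L * p x ^ 2) ≤ Real.exp (2 * M * (b - a)) * (3 * (b-a)^4 + 4 * (b-a)^2) / (∫ x in a..b, ((x-a)*(b-x))^2 * w x) * (L + 1) := by
  have hp1 : Continuous p1 := continuous_iff_continuousAt.2 fun x => (h1 x).continuousAt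
  have hp : Continuous p := continuous_iff_continuousAt.2 fun x => (h0 x).continuousAt
  have hc2 : ContinuousOn (fun x => ((x-a)*(b-x))^2 * w x) (Icc a b) := by fun_prop
  have hc3 : ContinuousOn (fun x => ((x-a)*(b-x))^2 * w x * (p1 x ^ 2 + L * p x ^ 2)) (Icc a b) := by fun_prop
  have hI : 0 < ∫ x in a..b, ((x-a)*(b-x))^2 * w x := by
    refine intervalIntegral.intervalIntegral_pos_of_pos_on (hc2.intervalIntegrable_of_Icc hab.le) (fun x hx => ?_) hab
    have := hwpos x (Ioo_subset_Icc_self hx)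
    have : 0 < (x-a)*(b-x) := mul_pos (by linarith [hx.1]) (by linarith [hx.2])
    positivity
  have hint := energy_int hab hL h0 hp1 hw hwpos hwp hnorm
  have hle : ∫ y in a..b, (p1 x ^ 2 + L * p x ^ 2) * (((y-a)*(b-y))^2 * w y) ≤
      ∫ y in a..b, Real.exp (2 * M * (b - a)) * (((y-a)*(b-y))^2 * w y * (p1 y ^ 2 + L * p y ^ 2)) := by
    refine intervalIntegral.integral_mono_on hab.le ((hc2.intervalIntegrable_of_Icc hab.le).const_mul _)
      ((hc3.intervalIntegrable_of_Icc hab.le).const_mul _) fun y hy => ?_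
    have := energy_compare hM hL h0 h1 hq hode hx hy
    have w0 := hwpos y hy
    have w1 : 0 ≤ ((y-a)*(b-y))^2 * w y := by positivity
    have := mul_le_mul_of_nonneg_right this w1
    linarith
  rw [intervalIntegral.integral_const_mul, intervalIntegral.integral_const_mul] at hle
  rw [div_mul_eq_mul_div, le_div_iff₀ hI]
  refine hle.trans ?_
  rw [mul_assoc (Real.exp (2 * M * (b - a)))]
  refine mul_le_mul_of_nonneg_left (hint.trans ?_) (Real.exp_pos _).le
  have : 0 ≤ (b-a)^4 := by positivity
  have : 0 ≤ (b-a)^2 := by positivity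
  nlinarith

lemma jacLam_lower {α β : ℝ} (hα : -1 < α) (hβ : -1 < β) (n : ℕ) (hn : 1 ≤ n) :
    α+β+2 ≤ jacLam α β n := by
  have : (1:ℝ) ≤ n := by exact_mod_cast hn
  unfold jacLam
  nlinarith

lemma jac_norm_Icc {α β : ℝ} (hα : -1 < α) (hβ : -1 < β) {c : ℕ → ℝ} (hc : JacobiNormalized α β c) {a b : ℝ}
    (ha : 0 < a) (hab : a < b) (hb : b < π) (n : ℕ) : ∫ x in a..b, jacW α β x * nJacobi α β c n x ^ 2 ≤ 1 := by
  have h := hc.2 n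
  rw [jac_integral] at h
  have hint : IntegrableOn (fun x => jacW α β x * nJacobi α β c n x ^ 2) (Ioo 0 π) := by
    by_contra hcon
    rw [integral_undef hcon] at h
    exact zero_ne_one h
  rw [intervalIntegral.integral_of_le hab.le, ← h]
  refine setIntegral_mono_set hint ?_ ?_
  · filter_upwards [ae_restrict_mem measurableSet_Ioo] with x hx
    have := jacW_pos α β hx
    simp only [Pi.zero_apply]
    positivity
  · exact Filter.Eventually.of_forall fun x hx => ⟨ha.trans hx.1, hx.2.trans_lt hb⟩

lemma jac_low {α β : ℝ} (hα : -1 < α) (hβ : -1 < β) {c : ℕ → ℝ} (hc : JacobiNormalized α β c) {a b : ℝ}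
    (ha : 0 < a) (hab : a < b) (hb : b < π) :
    JBd a b 0 (nJacobi α β c) ∧ JBd a b 1 (fun n => deriv (nJacobi α β c n)) := by
  have hsub : ∀ x ∈ Icc a b, x ∈ Ioo 0 π := fun x hx => ⟨ha.trans_le hx.1, hx.2.trans_lt hb⟩
  have hs : ∀ x ∈ Icc a b, Real.sin x ≠ 0 := fun x hx =>
    (Real.sin_pos_of_pos_of_lt_pi (hsub x hx).1 (hsub x hx).2).ne'
  have hqc : ContinuousOn (fun x => jacB α β x / Real.sin x) (Icc a b) :=
    (jacB_contDiff α β).continuous.continuousOn.div Real.continuous_sin.continuousOn hs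
  obtain ⟨M, hM⟩ := isCompact_Icc.exists_bound_of_continuousOn hqc
  have hw : ContinuousOn (jacW α β) (Icc a b) := (jacW_continuousOn α β).mono hsub
  set C := Real.exp (2 * (max M 0) * (b - a)) * (3 * (b-a)^4 + 4 * (b-a)^2) / (∫ x in a..b, ((x-a)*(b-x))^2 * jacW α β x) with hCdef
  have hκ : 0 < α + β + 2 := by linarith
  have main : ∀ n, 1 ≤ n → ∀ x ∈ Icc a b, deriv (nJacobi α β c n) x ^ 2 + jacLam α β n * nJacobi α β c n x ^ 2 ≤ C * (jacLam α β n + 1) := by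
    intro n hn x hx
    have hL : 0 ≤ jacLam α β n := hκ.le.trans (jacLam_lower hα hβ n hn)
    have hp := nJacobi_contDiff α β c n
    have hp1 := (contDiff_infty_iff_deriv.1 hp).2
    refine energy_final (p := nJacobi α β c n) (p1 := deriv (nJacobi α β c n)) (p2 := deriv (deriv (nJacobi α β c n)))
      (q := fun x => jacB α β x / Real.sin x) hab (le_max_right M 0) hL (fun x => (hp.differentiable (by simp) x).hasDerivAt)
      (fun x => (hp1.differentiable (by simp) x).hasDerivAt) (fun x hx => (hM x hx).trans (le_max_left _ _)) (fun x hx => ?_)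
      hw (fun x hx => jacW_pos α β (hsub x hx)) (fun x hx => jacWp_hasDerivAt hα hβ c n (hsub x hx))
      (jac_norm_Icc hα hβ hc ha hab hb n) hx
    have := nJacobi_ode hα hβ c n x
    have hsx := hs x hx
    field_simp
    linarith
  obtain ⟨CL, hCL, hLb⟩ := jacLam_bd α β
  have hC : 0 ≤ C := by
    have h1 := main 1 le_rfl a ⟨le_rfl, hab.le⟩
    have hL : 0 ≤ jacLam α β 1 := hκ.le.trans (jacLam_lower hα hβ 1 le_rfl)
    have : 0 ≤ C * (jacLam α β 1 + 1) := le_trans (by positivity) h1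
    exact nonneg_of_mul_nonneg_left this (by linarith)
  constructor
  · refine ⟨|c 0| + Real.sqrt (C * (1 + 1/(α+β+2))), by positivity, fun n x hx => ?_⟩
    rw [pow_zero, mul_one]
    rcases Nat.eq_zero_or_pos n with rfl | hn
    · rw [nJacobi_zero hα hβ]
      linarith [Real.sqrt_nonneg (C * (1 + 1/(α+β+2)))]
    · have h1 := main n hn x hx
      have hL := jacLam_lower hα hβ n hn
      have hL0 : 0 < jacLam α β n := hκ.trans_le hL
      have : nJacobi α β c n x ^ 2 ≤ C * (1 + 1/(α+β+2)) := by
        have h2 : jacLam α β n * nJacobi α β c n x ^ 2 ≤ jacLam α β n * (C * (1 + 1/(α+β+2))) := by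
          have h3 : 1 ≤ jacLam α β n * (1/(α+β+2)) := by
            rw [mul_one_div, le_div_iff₀ hκ]; linarith
          nlinarith [sq_nonneg (deriv (nJacobi α β c n) x), mul_le_mul_of_nonneg_left h3 hC]
        exact le_of_mul_le_mul_left h2 hL0
      have := Real.abs_le_sqrt this
      linarith [abs_nonneg (c 0)]
  · refine ⟨Real.sqrt (C * (CL + 1)), by positivity, fun n x hx => ?_⟩
    rw [pow_one]
    rcases Nat.eq_zero_or_pos n with rfl | hn
    · have : nJacobi α β c 0 = fun _ => c 0 := funext (nJacobi_zero hα hβ c)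
      beta_reduce
      rw [this]
      simp
    · have h1 := main n hn x hx
      have hL := jacLam_lower hα hβ n hn
      have hL0 : 0 < jacLam α β n := hκ.trans_le hL
      have h2 : deriv (nJacobi α β c n) x ^ 2 ≤ (C * (CL + 1)) * ((n:ℝ)+1)^2 := by
        have h3 : jacLam α β n + 1 ≤ (CL + 1) * ((n:ℝ)+1)^2 := by
          have := (le_abs_self _).trans (hLb n)
          have hn0 : (0:ℝ) ≤ n := Nat.cast_nonneg n
          nlinarith
        have := mul_le_mul_of_nonneg_left h3 hC
        have h4 : 0 ≤ jacLam α β n * nJacobi α β c n x ^ 2 := by positivity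
        linarith
      have := Real.abs_le_sqrt h2
      rwa [Real.sqrt_mul (by positivity), Real.sqrt_sq (by positivity)] at this

lemma jac_bounds {α β : ℝ} (hα : -1 < α) (hβ : -1 < β) {c : ℕ → ℝ} (hc : JacobiNormalized α β c) {a b : ℝ}
    (ha : 0 < a) (hab : a < b) (hb : b < π) (k : ℕ) :
    JBd a b k (fun n => iteratedDeriv k (nJacobi α β c n)) :=
  jac_bounds_of_low hα hβ c ha hb (jac_low hα hβ hc ha hab hb).1 (jac_low hα hβ hc ha hab hb).2 k



/-! ### Part 6: coefficient decay -/

lemma jac_zero_of_supp {f : ℝ → ℝ} {a b x : ℝ} (hs : tsupport f ⊆ Ioo a b) (hx : x ∉ Ioo a b) : f x = 0 :=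
  image_eq_zero_of_notMem_tsupport fun h => hx (hs h)

lemma jac_int_supp {α β : ℝ} {f g : ℝ → ℝ} {a b : ℝ} (ha : 0 < a) (hab : a < b) (hb : b < π)
    (hs : tsupport f ⊆ Ioo a b) : ∫ x, g x * f x ∂(jacobiMeasure α β) = ∫ x in a..b, jacW α β x * (g x * f x) := by
  rw [jac_integral, intervalIntegral.integral_of_le hab.le]
  refine setIntegral_eq_of_subset_of_forall_sdiff_eq_zero measurableSet_Ioo
    (fun x hx => ⟨ha.trans hx.1, hx.2.trans_lt hb⟩) fun x hx => ?_
  rw [jac_zero_of_supp hs fun h => hx.2 (Ioo_subset_Ioc_self h)]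
  ring

lemma jac_coeff {α β : ℝ} (hα : -1 < α) (hβ : -1 < β) {c : ℕ → ℝ} (hc : JacobiNormalized α β c) {a b : ℝ}
    (ha : 0 < a) (hab : a < b) (hb : b < π) {f : ℝ → ℝ} (hf : ContDiff ℝ (⊤ : ℕ∞) f)
    (hs : tsupport f ⊆ Ioo a b) :
    ∃ C, 0 ≤ C ∧ ∀ n : ℕ, |jacobiInner α β f (nJacobi α β c (n+1))| ≤ C / ((n:ℝ)+1) := by
  have hsub : ∀ x ∈ Icc a b, x ∈ Ioo 0 π := fun x hx => ⟨ha.trans_le hx.1, hx.2.trans_lt hb⟩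
  have hw : ContinuousOn (jacW α β) (Icc a b) := (jacW_continuousOn α β).mono hsub
  have hf1 := (contDiff_infty_iff_deriv.1 hf).2
  obtain ⟨C1, hC1, h1⟩ := (JBd.of_cont (h := fun x => deriv f x * jacW α β x) (a := a) (b := b)
    (hf1.continuous.continuousOn.mul hw)).mul (jac_low hα hβ hc ha hab hb).2
  set m := min (α+β+2) 1 with hm
  have hm0 : 0 < m := lt_min (by linarith) one_pos
  have hm1 : m ≤ α+β+2 := min_le_left _ _
  have hm2 : m ≤ 1 := min_le_right _ _
  refine ⟨2 * C1 * (b-a) / m, by have := sub_pos.2 hab; positivity, fun n => ?_⟩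
  set p := nJacobi α β c (n+1) with hp
  have hpc : ContDiff ℝ (⊤ : ℕ∞) p := nJacobi_contDiff α β c (n+1)
  have hp1 := (contDiff_infty_iff_deriv.1 hpc).2
  have hpcc := hpc.continuous
  have hp1c := hp1.continuous
  have hfc := hf.continuous
  have hf1c := hf1.continuous
  have hL : m * ((n:ℝ)+1)^2 ≤ jacLam α β (n+1) := by
    unfold jacLam
    push_cast
    have hn : (0:ℝ) ≤ n := Nat.cast_nonneg n
    have : m * ((n:ℝ)+1) ≤ n + 1 + α + β + 1 := by nlinarith
    nlinarith
  have e0 : jacobiInner α β f p = ∫ x in a..b, jacW α β x * (p x * f x) := by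
    rw [← jac_int_supp ha hab hb hs]
    unfold jacobiInner
    congr 1; ext x; ring
  have hder : ∀ x ∈ Icc a b, HasDerivAt (fun x => f x * (jacW α β x * deriv p x))
      (deriv f x * (jacW α β x * deriv p x) + f x * (-(jacLam α β (n+1) * (jacW α β x * p x)))) x := fun x hx =>
    ((hf.differentiable (by simp) x).hasDerivAt).mul (jacWp_hasDerivAt hα hβ c (n+1) (hsub x hx))
  have hi1 : IntervalIntegrable (fun x => deriv f x * (jacW α β x * deriv p x)) volume a b :=
    ContinuousOn.intervalIntegrable_of_Icc hab.le (by fun_prop)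
  have hi2 : IntervalIntegrable (fun x => f x * (-(jacLam α β (n+1) * (jacW α β x * p x)))) volume a b :=
    ContinuousOn.intervalIntegrable_of_Icc hab.le (by fun_prop)
  have e1 := intervalIntegral.integral_eq_sub_of_hasDerivAt_of_le hab.le
    (fun x hx => (hder x hx).continuousAt.continuousWithinAt)
      (fun x hx => hder x (Ioo_subset_Icc_self hx)) (hi1.add hi2)
  rw [intervalIntegral.integral_add hi1 hi2, jac_zero_of_supp hs (by simp : a ∉ Ioo a b),
    jac_zero_of_supp hs (by simp : b ∉ Ioo a b), zero_mul, zero_mul, sub_zero] at e1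
  have e2 : ∫ x in a..b, f x * (-(jacLam α β (n+1) * (jacW α β x * p x))) = -(jacLam α β (n+1) * jacobiInner α β f p) := by
    rw [e0, ← intervalIntegral.integral_const_mul, ← intervalIntegral.integral_neg]
    congr 1; ext x; ring
  have e3 : |∫ x in a..b, deriv f x * (jacW α β x * deriv p x)| ≤ C1 * ((n:ℝ)+2) * (b-a) := by
    have := intervalIntegral.norm_integral_le_of_norm_le_const (a := a) (b := b) (f := fun x => deriv f x * (jacW α β x * deriv p x))
      (C := C1 * ((n:ℝ)+2)) fun x hx => by
        rw [uIoc_of_le hab.le] at hx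
        have := h1 (n+1) x (Ioc_subset_Icc_self hx)
        push_cast at this
        rw [Real.norm_eq_abs, ← mul_assoc]
        refine this.trans (le_of_eq ?_)
        ring
    rwa [abs_of_pos (sub_pos.2 hab), Real.norm_eq_abs] at this
  have e4 : jacLam α β (n+1) * jacobiInner α β f p = ∫ x in a..b, deriv f x * (jacW α β x * deriv p x) := by linarith
  rw [← e4, abs_mul] at e3
  have hn : (0:ℝ) ≤ n := Nat.cast_nonneg n
  have hba := sub_pos.2 hab
  have e5 : m * ((n:ℝ)+1)^2 * |jacobiInner α β f p| ≤ C1 * (b-a) * (2 * (n+1)) := by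
    calc m * ((n:ℝ)+1)^2 * |jacobiInner α β f p| ≤ |jacLam α β (n+1)| * |jacobiInner α β f p| := by
          gcongr; exact hL.trans (le_abs_self _)
      _ ≤ _ := e3
      _ = C1 * (b-a) * (n+2) := by ring
      _ ≤ _ := by gcongr; linarith
  rw [le_div_iff₀ (by positivity), le_div_iff₀ hm0]
  have : (n+1:ℝ) * (|jacobiInner α β f p| * (n+1) * m) ≤ (n+1) * (2 * C1 * (b-a)) := by linarith
  exact le_of_mul_le_mul_left this (by positivity)



/-! ### Part 7: kernel bounds -/

def jacLa (α β : ℝ) (n : ℕ) : ℝ := (n:ℝ) + 1 + jacobiTau α β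

lemma jacLa_lower {α β : ℝ} (hα : -1 < α) (hβ : -1 < β) (n : ℕ) : (n:ℝ) + 1/2 ≤ jacLa α β n := by
  unfold jacLa jacobiTau; linarith

lemma jacLa_pos {α β : ℝ} (hα : -1 < α) (hβ : -1 < β) (n : ℕ) : 0 < jacLa α β n :=
  lt_of_lt_of_le (by positivity) (jacLa_lower hα hβ n)

lemma pow_mul_exp_bd (M : ℕ) {x : ℝ} (hx : 0 ≤ x) :
    x ^ M * Real.exp (-x) ≤ (2^M * (M.factorial:ℝ)) * Real.exp (-(x/2)) := by
  have h := Real.pow_div_factorial_le_exp (x/2) (by positivity) M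
  rw [div_le_iff₀ (by positivity)] at h
  have h1 : x ^ M ≤ 2^M * (M.factorial:ℝ) * Real.exp (x/2) := by
    calc x ^ M = 2^M * (x/2)^M := by rw [div_pow]; field_simp
      _ ≤ 2^M * (Real.exp (x/2) * M.factorial) := by gcongr
      _ = _ := by ring
  calc x ^ M * Real.exp (-x) ≤ 2^M * (M.factorial:ℝ) * Real.exp (x/2) * Real.exp (-x) := by gcongr
    _ = 2^M * (M.factorial:ℝ) * Real.exp (-(x/2)) := by
      rw [mul_assoc, ← Real.exp_add]; congr 2; ring

lemma exp_geom {y : ℝ} (hy : 0 < y) : Summable (fun n : ℕ => Real.exp (-(y*((n:ℝ)+1)))) ∧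
    ∑' n : ℕ, Real.exp (-(y*((n:ℝ)+1))) ≤ 1 / y := by
  have hr : Real.exp (-y) < 1 := by rw [← Real.exp_zero]; exact Real.exp_lt_exp.2 (by linarith)
  have h := (hasSum_geometric_of_lt_one (Real.exp_pos (-y)).le hr).mul_left (Real.exp (-y))
  have e : (fun n : ℕ => Real.exp (-y) * Real.exp (-y)^n) = fun n : ℕ => Real.exp (-(y*((n:ℝ)+1))) := by
    ext n
    rw [← Real.exp_nat_mul, ← Real.exp_add]; congr 1; ring
  rw [e] at h
  refine ⟨h.summable, ?_⟩
  rw [h.tsum_eq, ← div_eq_mul_inv, div_le_div_iff₀ (by linarith) hy, one_mul]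
  have h2 : Real.exp (-y) * (1 + y) ≤ 1 := by
    calc Real.exp (-y) * (1+y) ≤ Real.exp (-y) * Real.exp y := by
          gcongr; linarith [Real.add_one_le_exp y]
      _ = 1 := by rw [← Real.exp_add]; simp
  linarith

/-- summation bound for exponentials -/
lemma jac_exp_sum {α β : ℝ} (hα : -1 < α) (hβ : -1 < β) {t : ℝ} (ht : 0 < t) :
    Summable (fun n : ℕ => Real.exp (-(t * jacLa α β n / 2))) ∧
    ∑' n : ℕ, Real.exp (-(t * jacLa α β n / 2)) ≤ 8 / t * Real.exp (-(t/8)) := by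
  have hle : ∀ n : ℕ, Real.exp (-(t * jacLa α β n / 2)) ≤ Real.exp (-(t/8)) * Real.exp (-(t/8*((n:ℝ)+1))) := by
    intro n
    rw [← Real.exp_add]
    apply Real.exp_le_exp.2
    have h1 := jacLa_lower hα hβ n
    have hn : (0:ℝ) ≤ n := Nat.cast_nonneg n
    have := mul_le_mul_of_nonneg_left h1 ht.le
    nlinarith [mul_nonneg ht.le hn]
  obtain ⟨h1, h2⟩ := exp_geom (y := t/8) (by positivity)
  have hs : Summable (fun n : ℕ => Real.exp (-(t * jacLa α β n / 2))) :=
    Summable.of_nonneg_of_le (fun n => (Real.exp_pos _).le) hle (h1.mul_left _)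
  refine ⟨hs, (hs.tsum_le_tsum hle (h1.mul_left _)).trans ?_⟩
  rw [tsum_mul_left]
  calc _ ≤ Real.exp (-(t/8)) * (1/(t/8)) := by gcongr
    _ = _ := by field_simp

/-- the core weight bound: `t^M e^{-tλ} λ^M ≤ C e^{-tλ/2}`. -/
lemma jac_weight {α β : ℝ} (hα : -1 < α) (hβ : -1 < β) (M : ℕ) {t : ℝ} (ht : 0 < t) (n : ℕ) :
    t ^ M * (Real.exp (-(t * jacLa α β n)) * jacLa α β n ^ M) ≤
      (2^M * (M.factorial:ℝ)) * Real.exp (-(t * jacLa α β n / 2)) := by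
  have := pow_mul_exp_bd M (x := t * jacLa α β n) (mul_nonneg ht.le (jacLa_pos hα hβ n).le)
  rw [mul_pow] at this
  linarith

/-- polynomial growth in terms of `λ` -/
lemma jac_pow_le {α β : ℝ} (hα : -1 < α) (hβ : -1 < β) {k M : ℕ} (hk : k ≤ M) (n : ℕ) :
    ((n:ℝ)+3)^k ≤ (6^M) * jacLa α β n ^ M := by
  have h1 := jacLa_lower hα hβ n
  have hn : (0:ℝ) ≤ n := Nat.cast_nonneg n
  calc ((n:ℝ)+3)^k ≤ ((n:ℝ)+3)^M := pow_le_pow_right₀ (by linarith) hk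
    _ ≤ (6 * jacLa α β n)^M := by gcongr; linarith
    _ = _ := by rw [mul_pow]

lemma JBd.shift {a b : ℝ} {k : ℕ} {g : ℕ → ℝ → ℝ} (h : JBd a b k g) :
    ∃ C, 0 ≤ C ∧ ∀ n, ∀ x ∈ Icc a b, |g n x| ≤ C * ((n:ℝ)+3)^k ∧ |g (n+1) x| ≤ C * ((n:ℝ)+3)^k
      ∧ |g (n+2) x| ≤ C * ((n:ℝ)+3)^k := by
  obtain ⟨C, hC, h⟩ := h
  refine ⟨C, hC, fun n x hx => ⟨(h n x hx).trans ?_, (h (n+1) x hx).trans ?_, (h (n+2) x hx).trans ?_⟩⟩ <;>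
  · refine mul_le_mul_of_nonneg_left (pow_le_pow_left₀ (by positivity) ?_ k) hC
    push_cast
    linarith

def jacT (α β : ℝ) (c : ℕ → ℝ) (k : ℕ) (t θ φ : ℝ) (n : ℕ) : ℝ :=
  Real.exp (-(t * jacLa α β n)) * iteratedDeriv k (nJacobi α β c (n+1)) θ * nJacobi α β c (n+1) φ

def jacS (α β : ℝ) (c : ℕ → ℝ) (k : ℕ) (t θ φ : ℝ) : ℝ := ∑' n, jacT α β c k t θ φ n

lemma jac_B1 {α β : ℝ} (hα : -1 < α) (hβ : -1 < β) {c : ℕ → ℝ} (hc : JacobiNormalized α β c) {a b : ℝ}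
    (ha : 0 < a) (hab : a < b) (hb : b < π) {k M : ℕ} (hk : k ≤ M) :
    ∃ C, 0 ≤ C ∧ ∀ t, 0 < t → ∀ θ ∈ Icc a b, ∀ φ ∈ Icc a b, ∀ n,
      |t ^ M * jacT α β c k t θ φ n| ≤ C * Real.exp (-(t * jacLa α β n / 2)) := by
  obtain ⟨C1, hC1, h1⟩ := (jac_bounds hα hβ hc ha hab hb k).shift
  obtain ⟨C2, hC2, h2⟩ := (jac_low hα hβ hc ha hab hb).1
  refine ⟨C1 * C2 * 6^M * (2^M * (M.factorial:ℝ)), by positivity, fun t ht θ hθ φ hφ n => ?_⟩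
  have e1 := (h1 n θ hθ).2.1
  have e2 := h2 (n+1) φ hφ
  rw [pow_zero, mul_one] at e2
  have hw := jac_weight hα hβ M ht n
  have hp := jac_pow_le hα hβ hk n
  unfold jacT
  rw [abs_mul, abs_mul, abs_mul, abs_of_pos (Real.exp_pos _), abs_of_pos (pow_pos ht M)]
  have hla := jacLa_pos hα hβ n
  calc t ^ M * (Real.exp (-(t * jacLa α β n)) * |iteratedDeriv k (nJacobi α β c (n+1)) θ| * |nJacobi α β c (n+1) φ|)
      ≤ t ^ M * (Real.exp (-(t * jacLa α β n)) * (C1 * (6^M * jacLa α β n ^ M)) * C2) := by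
        gcongr
        exact e1.trans (by gcongr)
    _ = C1 * C2 * 6^M * (t ^ M * (Real.exp (-(t * jacLa α β n)) * jacLa α β n ^ M)) := by ring
    _ ≤ C1 * C2 * 6^M * ((2^M * (M.factorial:ℝ)) * Real.exp (-(t * jacLa α β n / 2))) := by gcongr
    _ = _ := by ring

lemma jacT_summable {α β : ℝ} (hα : -1 < α) (hβ : -1 < β) {c : ℕ → ℝ} (hc : JacobiNormalized α β c) {a b : ℝ}
    (ha : 0 < a) (hab : a < b) (hb : b < π) (k : ℕ) {t : ℝ} (ht : 0 < t) {θ φ : ℝ} (hθ : θ ∈ Icc a b) (hφ : φ ∈ Icc a b) :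
    Summable (jacT α β c k t θ φ) := by
  obtain ⟨C, hC, h⟩ := jac_B1 hα hβ hc ha hab hb (le_refl k)
  have : Summable fun n => t^k * jacT α β c k t θ φ n :=
    Summable.of_norm_bounded ((jac_exp_sum hα hβ ht).1.mul_left C) fun n => h t ht θ hθ φ hφ n
  exact (summable_mul_left_iff (pow_pos ht k).ne').1 this

lemma jac_S1 {α β : ℝ} (hα : -1 < α) (hβ : -1 < β) {c : ℕ → ℝ} (hc : JacobiNormalized α β c) {a b : ℝ}
    (ha : 0 < a) (hab : a < b) (hb : b < π) {k M : ℕ} (hk : k ≤ M) :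
    ∃ C, 0 ≤ C ∧ ∀ t, 0 < t → ∀ θ ∈ Icc a b, ∀ φ ∈ Icc a b,
      |t ^ M * jacS α β c k t θ φ| ≤ C / t * Real.exp (-(t/8)) := by
  obtain ⟨C, hC, h⟩ := jac_B1 hα hβ hc ha hab hb hk
  refine ⟨C * 8, by positivity, fun t ht θ hθ φ hφ => ?_⟩
  unfold jacS
  rw [← tsum_mul_left]
  have hs := jac_exp_sum hα hβ ht
  have := tsum_of_norm_bounded (f := fun n => t ^ M * jacT α β c k t θ φ n) (hs.1.mul_left C).hasSum (fun n => h t ht θ hθ φ hφ n)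
  rw [Real.norm_eq_abs] at this
  refine this.trans ((le_of_eq tsum_mul_left).trans ((mul_le_mul_of_nonneg_left hs.2 hC).trans (le_of_eq ?_)))
  ring

def jacRem (α β : ℝ) (c : ℕ → ℝ) (k n : ℕ) (x : ℝ) : ℝ :=
  iteratedDeriv k (fun x => jacU x * nJacobi α β c n x) x - jacU x * iteratedDeriv k (nJacobi α β c n) x

def jacD (α β : ℝ) (c A : ℕ → ℝ) (k n : ℕ) (θ φ : ℝ) : ℝ :=
  A n * (iteratedDeriv k (nJacobi α β c (n+1)) θ * nJacobi α β c n φ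
    - iteratedDeriv k (nJacobi α β c n) θ * nJacobi α β c (n+1) φ)

lemma jac_identity {α β : ℝ} {c : ℕ → ℝ} {A : ℕ → ℝ}
    (hA : ∀ n θ φ, (jacU θ - jacU φ) * nJacobi α β c (n+1) θ * nJacobi α β c (n+1) φ =
      A (n+1) * (nJacobi α β c (n+2) θ * nJacobi α β c (n+1) φ - nJacobi α β c (n+1) θ * nJacobi α β c (n+2) φ)
      - A n * (nJacobi α β c (n+1) θ * nJacobi α β c n φ - nJacobi α β c n θ * nJacobi α β c (n+1) φ))
    (k n : ℕ) (θ φ : ℝ) :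
    (jacU θ - jacU φ) * (iteratedDeriv k (nJacobi α β c (n+1)) θ * nJacobi α β c (n+1) φ) =
      jacD α β c A k (n+1) θ φ - jacD α β c A k n θ φ - jacRem α β c k (n+1) θ * nJacobi α β c (n+1) φ := by
  have hp : ∀ n, ContDiff ℝ (k:ℕ∞) (nJacobi α β c n) := fun n =>
    (nJacobi_contDiff α β c n).of_le (by exact_mod_cast le_top)
  have hU : ContDiff ℝ (k:ℕ∞) jacU := jacU_contDiff.of_le (by exact_mod_cast le_top)
  have e : (fun x => nJacobi α β c (n+1) φ * (jacU x * nJacobi α β c (n+1) x)) = fun x =>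
      ((jacU φ * nJacobi α β c (n+1) φ + A n * -nJacobi α β c n φ - A (n+1) * nJacobi α β c (n+2) φ) * nJacobi α β c (n+1) x
      + (A (n+1) * nJacobi α β c (n+1) φ) * nJacobi α β c (n+2) x)
      + (A n * nJacobi α β c (n+1) φ) * nJacobi α β c n x := by
    ext x
    linear_combination hA n x φ
  have e2 := congrArg (fun g => iteratedDeriv k g θ) e
  beta_reduce at e2
  rw [iteratedDeriv_fun_add ((contDiff_const.mul (hp _)).add (contDiff_const.mul (hp _))).contDiffAt (contDiff_const.mul (hp _)).contDiffAt,
    iteratedDeriv_fun_add (contDiff_const.mul (hp _)).contDiffAt (contDiff_const.mul (hp _)).contDiffAt,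
    iteratedDeriv_const_mul_field, iteratedDeriv_const_mul_field, iteratedDeriv_const_mul_field, iteratedDeriv_const_mul_field] at e2
  unfold jacD jacRem
  linear_combination e2

/-- Abel summation -/
lemma abel_sum {g D : ℕ → ℝ} (h1 : Summable fun n => g n * D n) (h2 : Summable fun n => g n * D (n+1)) :
    Summable (fun n => (g n - g (n+1)) * D (n+1)) ∧
    ∑' n, g n * (D (n+1) - D n) = -(g 0 * D 0) + ∑' n, (g n - g (n+1)) * D (n+1) := by
  have h3 : Summable fun n => g (n+1) * D (n+1) := (summable_nat_add_iff 1).2 h1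
  have e1 : (fun n => g n * (D (n+1) - D n)) = fun n => g n * D (n+1) - g n * D n := by ext n; ring
  have e2 : (fun n => (g n - g (n+1)) * D (n+1)) = fun n => g n * D (n+1) - g (n+1) * D (n+1) := by ext n; ring
  rw [e1, e2]
  refine ⟨h2.sub h3, ?_⟩
  rw [h2.tsum_sub h1, h2.tsum_sub h3, h1.tsum_eq_zero_add]
  ring



/-! ### Part 8: off-diagonal kernel bounds -/

lemma jacRem_bd {α β : ℝ} (hα : -1 < α) (hβ : -1 < β) {c : ℕ → ℝ} (hc : JacobiNormalized α β c) {a b : ℝ}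
    (ha : 0 < a) (hab : a < b) (hb : b < π) {k M : ℕ} (hk : k ≤ M) :
    ∃ C, 0 ≤ C ∧ ∀ t, 0 < t → ∀ θ ∈ Icc a b, ∀ φ ∈ Icc a b, ∀ n,
      |t ^ M * (Real.exp (-(t * jacLa α β n)) * (jacRem α β c k (n+1) θ * nJacobi α β c (n+1) φ))|
        ≤ C * (t * Real.exp (-(t * jacLa α β n / 2))) := by
  rcases k with _ | k
  · refine ⟨0, le_rfl, fun t ht θ _ φ _ n => ?_⟩
    simp [jacRem]
  · obtain ⟨M, rfl⟩ : ∃ M', M = M' + 1 := ⟨M - 1, by omega⟩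
    have hk' : k ≤ M := by omega
    have hr : JBd a b k (fun n => jacRem α β c (k+1) n) := by
      refine (JBd_leib_rem jacU_contDiff (nJacobi_contDiff α β c) 0 (k+1) fun i hi => ?_).mono (by omega)
      exact (jac_bounds hα hβ hc ha hab hb i).mono (by omega)
    obtain ⟨C1, hC1, h1⟩ := hr.shift
    obtain ⟨C2, hC2, h2⟩ := (jac_low hα hβ hc ha hab hb).1
    refine ⟨C1 * C2 * 6^M * (2^M * (M.factorial:ℝ)), by positivity, fun t ht θ hθ φ hφ n => ?_⟩
    have e1 := (h1 n θ hθ).2.1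
    have e2 := h2 (n+1) φ hφ
    rw [pow_zero, mul_one] at e2
    have hw := jac_weight hα hβ M ht n
    have hp := jac_pow_le hα hβ hk' n
    rw [abs_mul, abs_mul, abs_mul, abs_of_pos (Real.exp_pos _), abs_of_pos (pow_pos ht (M+1))]
    have hla := jacLa_pos hα hβ n
    calc t ^ (M+1) * (Real.exp (-(t * jacLa α β n)) * (|jacRem α β c (k+1) (n+1) θ| * |nJacobi α β c (n+1) φ|))
        ≤ t ^ (M+1) * (Real.exp (-(t * jacLa α β n)) * ((C1 * (6^M * jacLa α β n ^ M)) * C2)) := by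
          gcongr
          exact e1.trans (by gcongr)
      _ = C1 * C2 * 6^M * t * (t ^ M * (Real.exp (-(t * jacLa α β n)) * jacLa α β n ^ M)) := by ring
      _ ≤ C1 * C2 * 6^M * t * ((2^M * (M.factorial:ℝ)) * Real.exp (-(t * jacLa α β n / 2))) := by gcongr
      _ = _ := by ring

lemma jacD_bd {α β : ℝ} (hα : -1 < α) (hβ : -1 < β) {c : ℕ → ℝ} (hc : JacobiNormalized α β c) {a b : ℝ}
    (ha : 0 < a) (hab : a < b) (hb : b < π) {k M : ℕ} (hk : k ≤ M) {A : ℕ → ℝ} (hA : ∀ n, |A n| ≤ 1) :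
    ∃ C, 0 ≤ C ∧ ∀ t, 0 < t → ∀ θ ∈ Icc a b, ∀ φ ∈ Icc a b, ∀ n,
      t ^ M * (Real.exp (-(t * jacLa α β n)) * |jacD α β c A k n θ φ|) ≤ C * Real.exp (-(t * jacLa α β n / 2)) ∧
      t ^ M * (Real.exp (-(t * jacLa α β n)) * |jacD α β c A k (n+1) θ φ|) ≤ C * Real.exp (-(t * jacLa α β n / 2)) := by
  obtain ⟨C1, hC1, h1⟩ := (jac_bounds hα hβ hc ha hab hb k).shift
  obtain ⟨C2, hC2, h2⟩ := (jac_low hα hβ hc ha hab hb).1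
  refine ⟨2 * C1 * C2 * 6^M * (2^M * (M.factorial:ℝ)), by positivity, fun t ht θ hθ φ hφ n => ?_⟩
  have hw := jac_weight hα hβ M ht n
  have hp := jac_pow_le hα hβ hk n
  have hla := jacLa_pos hα hβ n
  have h2' : ∀ n, |nJacobi α β c n φ| ≤ C2 := fun n => by simpa using h2 n φ hφ
  have h1' := h1 n θ hθ
  set Q := C1 * (6^M * jacLa α β n ^ M) with hQ
  have hQ1 : C1 * ((n:ℝ)+3)^k ≤ Q := by rw [hQ]; gcongr
  have hQ0 : 0 ≤ Q := by positivity
  have gen : ∀ m, |iteratedDeriv k (nJacobi α β c (m+1)) θ| ≤ Q → |iteratedDeriv k (nJacobi α β c m) θ| ≤ Q →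
      |jacD α β c A k m θ φ| ≤ 2 * Q * C2 := by
    intro m g1 g2
    unfold jacD
    rw [abs_mul]
    calc _ ≤ 1 * (|iteratedDeriv k (nJacobi α β c (m+1)) θ * nJacobi α β c m φ|
            + |iteratedDeriv k (nJacobi α β c m) θ * nJacobi α β c (m+1) φ|) := by
          gcongr
          · exact hA m
          · exact abs_sub _ _
      _ ≤ 1 * (Q * C2 + Q * C2) := by
          rw [abs_mul, abs_mul]
          gcongr
          · exact h2' m
          · exact h2' (m+1)
      _ = _ := by ring
  have fin : ∀ m, |jacD α β c A k m θ φ| ≤ 2 * Q * C2 →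
      t ^ M * (Real.exp (-(t * jacLa α β n)) * |jacD α β c A k m θ φ|) ≤ 2 * C1 * C2 * 6^M * (2^M * (M.factorial:ℝ)) * Real.exp (-(t * jacLa α β n / 2)) := by
    intro m hm
    calc _ ≤ t ^ M * (Real.exp (-(t * jacLa α β n)) * (2 * Q * C2)) := by gcongr
      _ = 2 * C1 * C2 * 6^M * (t ^ M * (Real.exp (-(t * jacLa α β n)) * jacLa α β n ^ M)) := by rw [hQ]; ring
      _ ≤ 2 * C1 * C2 * 6^M * ((2^M * (M.factorial:ℝ)) * Real.exp (-(t * jacLa α β n / 2))) := by gcongr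
      _ = _ := by ring
  exact ⟨fin n (gen n (h1'.2.1.trans hQ1) (h1'.1.trans hQ1)), fin (n+1) (gen (n+1) (h1'.2.2.trans hQ1) (h1'.2.1.trans hQ1))⟩

lemma jac_S2 {α β : ℝ} (hα : -1 < α) (hβ : -1 < β) {c : ℕ → ℝ} (hc : JacobiNormalized α β c) {a b : ℝ}
    (ha : 0 < a) (hab : a < b) (hb : b < π) {k M : ℕ} (hk : k ≤ M) :
    ∃ C, 0 ≤ C ∧ ∀ t, 0 < t → ∀ θ ∈ Icc a b, ∀ φ ∈ Icc a b,
      |jacU θ - jacU φ| * |t ^ M * jacS α β c k t θ φ| ≤ C * Real.exp (-(t/8)) := by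
  obtain ⟨A, hA1, hA⟩ := jac_recurrence hα hβ hc
  obtain ⟨CR, hCR, hR⟩ := jacRem_bd hα hβ hc ha hab hb hk
  obtain ⟨CD, hCD, hD⟩ := jacD_bd hα hβ hc ha hab hb hk hA1
  refine ⟨CD + CD * 8 + CR * 8, by positivity, fun t ht θ hθ φ hφ => ?_⟩
  obtain ⟨hs1, hs2⟩ := jac_exp_sum hα hβ ht
  set g : ℕ → ℝ := fun n => t ^ M * Real.exp (-(t * jacLa α β n)) with hg
  set D : ℕ → ℝ := fun n => jacD α β c A k n θ φ with hDd
  set R : ℕ → ℝ := fun n => t ^ M * (Real.exp (-(t * jacLa α β n)) * (jacRem α β c k (n+1) θ * nJacobi α β c (n+1) φ)) with hRd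
  have habs : ∀ n m, |g n * D m| = t ^ M * (Real.exp (-(t * jacLa α β n)) * |jacD α β c A k m θ φ|) := by
    intro n m
    simp only [hg, hDd]
    rw [abs_mul, abs_mul, abs_of_pos (Real.exp_pos _), abs_of_pos (pow_pos ht M), mul_assoc]
  have q1 : Summable fun n => g n * D n :=
    Summable.of_norm_bounded (hs1.mul_left CD) fun n => by
      rw [Real.norm_eq_abs, habs]; exact (hD t ht θ hθ φ hφ n).1
  have q2 : Summable fun n => g n * D (n+1) :=
    Summable.of_norm_bounded (hs1.mul_left CD) fun n => by
      rw [Real.norm_eq_abs, habs]; exact (hD t ht θ hθ φ hφ n).2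
  have q3 : Summable R :=
    Summable.of_norm_bounded ((hs1.mul_left t).mul_left CR) fun n => hR t ht θ hθ φ hφ n
  obtain ⟨q4, q5⟩ := abel_sum q1 q2
  have q6 : Summable fun n => g n * (D (n+1) - D n) := by
    simpa only [mul_sub] using q2.sub q1
  have hsum : (jacU θ - jacU φ) * (t ^ M * jacS α β c k t θ φ) = ∑' n, g n * (D (n+1) - D n) - ∑' n, R n := by
    unfold jacS
    rw [← tsum_mul_left, ← tsum_mul_left, ← q6.tsum_sub q3]
    refine tsum_congr fun n => ?_
    have := jac_identity hA k n θ φ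
    simp only [hg, hDd, hRd, jacT]
    linear_combination (t ^ M * Real.exp (-(t * jacLa α β n))) * this
  have b1 : |g 0 * D 0| ≤ CD * Real.exp (-(t/8)) := by
    rw [habs]
    refine (hD t ht θ hθ φ hφ 0).1.trans ?_
    refine mul_le_mul_of_nonneg_left (Real.exp_le_exp.2 ?_) hCD
    have := jacLa_lower hα hβ 0
    push_cast at this
    nlinarith
  have b2 : |∑' n, (g n - g (n+1)) * D (n+1)| ≤ CD * 8 * Real.exp (-(t/8)) := by
    have hterm : ∀ n, ‖(g n - g (n+1)) * D (n+1)‖ ≤ CD * t * Real.exp (-(t * jacLa α β n / 2)) := by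
      intro n
      have hgn : 0 ≤ g n := by simp only [hg]; positivity
      have e : g (n+1) = g n * Real.exp (-t) := by
        simp only [hg]
        rw [mul_assoc, ← Real.exp_add]
        congr 2
        unfold jacLa; push_cast; ring
      have e1 : 1 - Real.exp (-t) ≤ t := by linarith [Real.add_one_le_exp (-t)]
      have e2 : 0 ≤ 1 - Real.exp (-t) := by
        have : Real.exp (-t) ≤ 1 := by rw [← Real.exp_zero]; exact Real.exp_le_exp.2 (by linarith)
        linarith
      have e3 : (g n - g (n+1)) * D (n+1) = (1 - Real.exp (-t)) * (g n * D (n+1)) := by rw [e]; ring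
      rw [e3, Real.norm_eq_abs, abs_mul, abs_of_nonneg e2, habs]
      calc _ ≤ t * (CD * Real.exp (-(t * jacLa α β n / 2))) := by
            apply mul_le_mul e1 (hD t ht θ hθ φ hφ n).2 (by positivity) ht.le
        _ = _ := by ring
    have := tsum_of_norm_bounded (hs1.mul_left (CD * t)).hasSum hterm
    rw [Real.norm_eq_abs] at this
    refine this.trans ((le_of_eq tsum_mul_left).trans ((mul_le_mul_of_nonneg_left hs2 (by positivity)).trans (le_of_eq ?_)))
    field_simp
  have b3 : |∑' n, R n| ≤ CR * 8 * Real.exp (-(t/8)) := by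
    have hterm : ∀ n, ‖R n‖ ≤ CR * t * Real.exp (-(t * jacLa α β n / 2)) := by
      intro n
      have := hR t ht θ hθ φ hφ n
      rw [mul_assoc]
      exact this
    have := tsum_of_norm_bounded (hs1.mul_left (CR * t)).hasSum hterm
    rw [Real.norm_eq_abs] at this
    refine this.trans ((le_of_eq tsum_mul_left).trans ((mul_le_mul_of_nonneg_left hs2 (by positivity)).trans (le_of_eq ?_)))
    field_simp
  rw [← abs_mul, hsum, q5]
  have t1 := abs_sub (-(g 0 * D 0) + ∑' n, (g n - g (n+1)) * D (n+1)) (∑' n, R n)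
  have t2 := abs_add_le (-(g 0 * D 0)) (∑' n, (g n - g (n+1)) * D (n+1))
  rw [abs_neg] at t2
  linarith

lemma cos_lower {a b : ℝ} (ha : 0 < a) (hab : a < b) (hb : b < π) :
    ∃ m, 0 < m ∧ ∀ θ ∈ Icc a b, ∀ φ ∈ Icc a b, m * |θ - φ| ≤ |jacU θ - jacU φ| := by
  have hsin : ContinuousOn Real.sin (Icc a b) := Real.continuous_sin.continuousOn
  obtain ⟨x0, hx0, hmin⟩ := isCompact_Icc.exists_isMinOn (nonempty_Icc.2 hab.le) hsin
  have hs0 : 0 < Real.sin x0 := Real.sin_pos_of_pos_of_lt_pi (ha.trans_le hx0.1) (hx0.2.trans_lt hb)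
  refine ⟨Real.sin x0 / π, by positivity, fun θ hθ φ hφ => ?_⟩
  have e : jacU θ - jacU φ = -(Real.sin ((θ+φ)/2) * Real.sin ((θ-φ)/2)) := by
    unfold jacU
    have := Real.cos_sub_cos θ φ
    linarith
  have h1 : Real.sin x0 ≤ Real.sin ((θ+φ)/2) := hmin ⟨by linarith [hθ.1, hφ.1], by linarith [hθ.2, hφ.2]⟩
  have h2 : |θ - φ| / π ≤ |Real.sin ((θ-φ)/2)| := by
    have h3 : |(θ-φ)/2| ≤ π/2 := by
      rw [abs_le]; constructor <;> linarith [hθ.1, hφ.1, hθ.2, hφ.2]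
    have := Real.mul_abs_le_abs_sin h3
    rw [abs_div, abs_two] at this
    refine le_trans (le_of_eq ?_) this
    field_simp
  rw [e, abs_neg, abs_mul, abs_of_nonneg (hs0.le.trans h1)]
  calc _ = Real.sin x0 * (|θ - φ| / π) := by ring
    _ ≤ _ := mul_le_mul h1 h2 (by positivity) (hs0.le.trans h1)

lemma jac_kernel_bd {α β : ℝ} (hα : -1 < α) (hβ : -1 < β) {c : ℕ → ℝ} (hc : JacobiNormalized α β c) {a b : ℝ}
    (ha : 0 < a) (hab : a < b) (hb : b < π) {k M : ℕ} (hk : k ≤ M) :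
    ∃ C, 0 ≤ C ∧ ∀ t, 0 < t → ∀ θ ∈ Icc a b, ∀ φ ∈ Icc a b, θ ≠ φ →
      |t ^ M * jacS α β c k t θ φ| ≤ C * (t ^ (-(1/2):ℝ) * Real.exp (-(t/8))) * |θ - φ| ^ (-(1/2):ℝ) := by
  obtain ⟨C1, hC1, h1⟩ := jac_S1 hα hβ hc ha hab hb hk
  obtain ⟨C2, hC2, h2⟩ := jac_S2 hα hβ hc ha hab hb hk
  obtain ⟨m, hm, h3⟩ := cos_lower ha hab hb
  refine ⟨Real.sqrt (C1 * C2 / m), by positivity, fun t ht θ hθ φ hφ hne => ?_⟩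
  have hd : 0 < |θ - φ| := abs_pos.2 (sub_ne_zero.2 hne)
  have e1 := h1 t ht θ hθ φ hφ
  have e2 := h2 t ht θ hθ φ hφ
  have e3 := h3 θ hθ φ hφ
  set G := |t ^ M * jacS α β c k t θ φ| with hG
  have hG0 : 0 ≤ G := abs_nonneg _
  have e4 : m * |θ - φ| * G ≤ C2 * Real.exp (-(t/8)) := (mul_le_mul_of_nonneg_right e3 hG0).trans e2
  have e5 : (m * |θ - φ| * G) * G ≤ (C2 * Real.exp (-(t/8))) * (C1 / t * Real.exp (-(t/8))) :=
    mul_le_mul e4 e1 hG0 (by positivity)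
  have e6 : G ^ 2 ≤ (Real.sqrt (C1 * C2 / m) * (t ^ (-(1/2):ℝ) * Real.exp (-(t/8))) * |θ - φ| ^ (-(1/2):ℝ)) ^ 2 := by
    have q1 : (t ^ (-(1/2):ℝ))^2 = t⁻¹ := by
      rw [← Real.rpow_natCast, ← Real.rpow_mul ht.le, ← Real.rpow_neg_one]; norm_num
    have q2 : (|θ - φ| ^ (-(1/2):ℝ))^2 = |θ-φ|⁻¹ := by
      rw [← Real.rpow_natCast, ← Real.rpow_mul hd.le, ← Real.rpow_neg_one]; norm_num
    rw [mul_pow, mul_pow, mul_pow, q1, q2, Real.sq_sqrt (by positivity)]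
    have : G ^ 2 = (m * |θ - φ| * G * G) / (m * |θ - φ|) := by field_simp
    rw [this, div_le_iff₀ (by positivity)]
    refine e5.trans (le_of_eq ?_)
    field_simp
  exact le_of_sq_le_sq e6 (by positivity)



/-! ### Part 9: differentiating the kernels -/

lemma iteratedDeriv_of_chain {s : Set ℝ} (hs : IsOpen s) {F : ℕ → ℝ → ℝ} {M : ℕ}
    (h : ∀ k, k < M → ∀ x ∈ s, HasDerivAt (F k) (F (k+1) x) x) :
    ∀ k, k ≤ M → ∀ x ∈ s, iteratedDeriv k (F 0) x = F k x := by
  intro k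
  induction k with
  | zero => intro _ x _; simp
  | succ k ih =>
    intro hk x hx
    rw [iteratedDeriv_succ]
    have he : iteratedDeriv k (F 0) =ᶠ[nhds x] F k :=
      Filter.eventuallyEq_of_mem (hs.mem_nhds hx) fun y hy => ih (by omega) y hy
    rw [he.deriv_eq, (h k (by omega) x hx).deriv]

lemma aesm_tsum {X : Type*} [MeasurableSpace X] {μ : Measure X} {u : ℕ → X → ℝ}
    (hu : ∀ n, AEStronglyMeasurable (u n) μ) (hs : ∀ᵐ x ∂μ, Summable fun n => u n x) :
    AEStronglyMeasurable (fun x => ∑' n, u n x) μ := by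
  refine aestronglyMeasurable_of_tendsto_ae atTop (f := fun N x => ∑ n ∈ Finset.range N, u n x) (fun N => ?_) ?_
  · exact Finset.aestronglyMeasurable_fun_sum _ fun i _ => hu i
  · filter_upwards [hs] with x hx
    exact hx.hasSum.tendsto_sum_nat

lemma jacS_hasDerivAt {α β : ℝ} (hα : -1 < α) (hβ : -1 < β) {c : ℕ → ℝ} (hc : JacobiNormalized α β c) {a b : ℝ}
    (ha : 0 < a) (hab : a < b) (hb : b < π) (k : ℕ) {t : ℝ} (ht : 0 < t) {θ φ : ℝ} (hθ : θ ∈ Ioo a b) (hφ : φ ∈ Icc a b) :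
    HasDerivAt (fun θ => jacS α β c k t θ φ) (jacS α β c (k+1) t θ φ) θ := by
  obtain ⟨C, hC, h⟩ := jac_B1 hα hβ hc ha hab hb (le_refl (k+1))
  have hs := (jac_exp_sum hα hβ ht).1
  have htp := pow_pos ht (k+1)
  refine hasDerivAt_tsum_of_isPreconnected (u := fun n => C / t ^ (k+1) * Real.exp (-(t * jacLa α β n / 2)))
    (g := fun n θ => jacT α β c k t θ φ n) (g' := fun n θ => jacT α β c (k+1) t θ φ n)
    (hs.mul_left _) isOpen_Ioo isPreconnected_Ioo (fun n y hy => ?_) (fun n y hy => ?_) hθ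
    (jacT_summable hα hβ hc ha hab hb k ht (Ioo_subset_Icc_self hθ) hφ) hθ
  · have hd : HasDerivAt (iteratedDeriv k (nJacobi α β c (n+1))) (iteratedDeriv (k+1) (nJacobi α β c (n+1)) y) y := by
      rw [iteratedDeriv_succ]
      exact ((nJacobi_contDiff α β c (n+1)).differentiable_iteratedDeriv k (by exact_mod_cast ENat.coe_lt_top k) y).hasDerivAt
    exact (hd.const_mul _).mul_const _
  · have := h t ht y (Ioo_subset_Icc_self hy) φ hφ n
    rw [abs_mul, abs_of_pos htp] at this
    rw [Real.norm_eq_abs, div_mul_eq_mul_div, le_div_iff₀ htp]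
    linarith

lemma jacS_meas {α β : ℝ} (hα : -1 < α) (hβ : -1 < β) {c : ℕ → ℝ} (hc : JacobiNormalized α β c) {a b : ℝ}
    (ha : 0 < a) (hab : a < b) (hb : b < π) (k M : ℕ) {θ φ : ℝ} (hθ : θ ∈ Icc a b) (hφ : φ ∈ Icc a b) :
    AEStronglyMeasurable (fun t => t ^ M * jacS α β c k t θ φ) (volume.restrict (Ioi 0)) := by
  refine (continuous_pow M).aestronglyMeasurable.mul (aesm_tsum (fun n => ?_) ?_)
  · refine Continuous.aestronglyMeasurable ?_
    unfold jacT
    fun_prop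
  · filter_upwards [ae_restrict_mem measurableSet_Ioi] with t ht
    exact jacT_summable hα hβ hc ha hab hb k ht hθ hφ

lemma jac_t_integrable : IntegrableOn (fun t : ℝ => t ^ (-(1/2):ℝ) * Real.exp (-(t/8))) (Ioi 0) := by
  have := integrableOn_rpow_mul_exp_neg_mul_rpow (s := -(1/2)) (p := 1) (b := 1/8) (by norm_num) (by norm_num) (by norm_num)
  refine this.congr_fun (fun t _ => ?_) measurableSet_Ioi
  simp only [Real.rpow_one]
  congr 2; ring

lemma jacI_integrable {α β : ℝ} (hα : -1 < α) (hβ : -1 < β) {c : ℕ → ℝ} (hc : JacobiNormalized α β c) {a b : ℝ}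
    (ha : 0 < a) (hab : a < b) (hb : b < π) {k M : ℕ} (hk : k ≤ M) {θ φ : ℝ} (hθ : θ ∈ Icc a b) (hφ : φ ∈ Icc a b)
    (hne : θ ≠ φ) : IntegrableOn (fun t => t ^ M * jacS α β c k t θ φ) (Ioi 0) := by
  obtain ⟨C, hC, h⟩ := jac_kernel_bd hα hβ hc ha hab hb hk
  refine Integrable.mono' ((jac_t_integrable.const_mul C).mul_const (|θ - φ| ^ (-(1/2):ℝ))) (jacS_meas hα hβ hc ha hab hb k M hθ hφ) ?_
  filter_upwards [ae_restrict_mem measurableSet_Ioi] with t ht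
  exact h t ht θ hθ φ hφ hne

lemma jacI_hasDerivAt {α β : ℝ} (hα : -1 < α) (hβ : -1 < β) {c : ℕ → ℝ} (hc : JacobiNormalized α β c) {a b : ℝ}
    (ha : 0 < a) (hab : a < b) (hb : b < π) {k M : ℕ} (hk : k < M) {θ φ : ℝ} (hθ : θ ∈ Ioo a b) (hφ : φ ∈ Icc a b)
    (hne : θ ≠ φ) : HasDerivAt (fun θ => ∫ t in Ioi (0:ℝ), t ^ M * jacS α β c k t θ φ)
      (∫ t in Ioi (0:ℝ), t ^ M * jacS α β c (k+1) t θ φ) θ := by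
  obtain ⟨C, hC, h⟩ := jac_kernel_bd hα hβ hc ha hab hb (show k+1 ≤ M by omega)
  have hd : 0 < |θ - φ| := abs_pos.2 (sub_ne_zero.2 hne)
  set s := Ioo a b ∩ Metric.ball θ (|θ - φ|/2) with hs
  have hsn : s ∈ nhds θ := Filter.inter_mem (isOpen_Ioo.mem_nhds hθ) (Metric.ball_mem_nhds θ (by positivity))
  have hds : ∀ x ∈ s, |θ - φ|/2 ≤ |x - φ| := by
    intro x hx
    have h1 : |x - θ| < |θ - φ|/2 := by simpa [Real.dist_eq] using hx.2
    have h2 := abs_sub_le θ x φ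
    rw [abs_sub_comm θ x] at h2
    linarith
  refine (hasDerivAt_integral_of_dominated_loc_of_deriv_le (F := fun θ t => t ^ M * jacS α β c k t θ φ)
    (F' := fun θ t => t ^ M * jacS α β c (k+1) t θ φ)
    (bound := fun t => C * (t ^ (-(1/2):ℝ) * Real.exp (-(t/8))) * (|θ - φ|/2) ^ (-(1/2):ℝ)) hsn ?_ ?_ ?_ ?_ ?_ ?_).2
  · filter_upwards [hsn] with x hx
    exact jacS_meas hα hβ hc ha hab hb k M (Ioo_subset_Icc_self hx.1) hφ
  · exact jacI_integrable hα hβ hc ha hab hb hk.le (Ioo_subset_Icc_self hθ) hφ hne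
  · exact jacS_meas hα hβ hc ha hab hb (k+1) M (Ioo_subset_Icc_self hθ) hφ
  · filter_upwards [ae_restrict_mem measurableSet_Ioi] with t ht x hx
    have hx2 := hds x hx
    have hxn : x ≠ φ := by
      rintro rfl
      rw [sub_self, abs_zero] at hx2
      linarith
    have ht' : 0 < t := ht
    refine (h t ht x (Ioo_subset_Icc_self hx.1) φ hφ hxn).trans ?_
    refine mul_le_mul_of_nonneg_left ?_ (by positivity)
    exact Real.rpow_le_rpow_of_nonpos (by positivity) hx2 (by norm_num)
  · exact (jac_t_integrable.const_mul C).mul_const _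
  · filter_upwards [ae_restrict_mem measurableSet_Ioi] with t ht x hx
    exact (jacS_hasDerivAt hα hβ hc ha hab hb k ht hx.1 hφ).const_mul _

lemma tildePoisson_eq {α β : ℝ} (hα : -1 < α) (hβ : -1 < β) {c : ℕ → ℝ} (hc : JacobiNormalized α β c) {a b : ℝ}
    (ha : 0 < a) (hab : a < b) (hb : b < π) {t : ℝ} (ht : 0 < t) {θ φ : ℝ} (hθ : θ ∈ Icc a b) (hφ : φ ∈ Icc a b) :
    tildePoissonKer α β c t θ φ = jacS α β c 0 t θ φ := by
  have hs := jacT_summable hα hβ hc ha hab hb 0 ht hθ hφ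
  have e : ∀ n : ℕ, Real.exp (-t * |((n+1:ℕ):ℝ) + jacobiTau α β|) * nJacobi α β c (n+1) θ * nJacobi α β c (n+1) φ
      = jacT α β c 0 t θ φ n := by
    intro n
    have := jacLa_pos hα hβ n
    unfold jacLa at this
    unfold jacT jacLa
    push_cast
    rw [abs_of_pos this, iteratedDeriv_zero, neg_mul]
  have hs2 : Summable fun n : ℕ => Real.exp (-t * |(n:ℝ) + jacobiTau α β|) * nJacobi α β c n θ * nJacobi α β c n φ := by
    rw [← summable_nat_add_iff 1]
    exact hs.congr fun n => (e n).symm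
  unfold tildePoissonKer poissonKer
  rw [hs2.tsum_eq_zero_add, tsum_congr e]
  unfold jacS
  simp

lemma tildePotential_iteratedDeriv {α β : ℝ} (hα : -1 < α) (hβ : -1 < β) {c : ℕ → ℝ} (hc : JacobiNormalized α β c) {a b : ℝ}
    (ha : 0 < a) (hab : a < b) (hb : b < π) {N j : ℕ} (hj : j ≤ N - 1) {θ φ : ℝ} (hθ : θ ∈ Ioo a b) (hφ : φ ∈ Icc a b)
    (hne : θ ≠ φ) : iteratedDeriv j (fun θ' => tildePotentialKer α β c N θ' φ) θ =
      (1 / Real.Gamma (N:ℝ)) * ∫ t in Ioi (0:ℝ), t ^ (N-1) * jacS α β c j t θ φ := by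
  have hopen : IsOpen (Ioo a b ∩ {φ}ᶜ) := isOpen_Ioo.inter isOpen_compl_singleton
  have hmem : θ ∈ Ioo a b ∩ {φ}ᶜ := ⟨hθ, hne⟩
  have key := iteratedDeriv_of_chain hopen (M := N-1)
    (F := fun k θ => (1 / Real.Gamma (N:ℝ)) * ∫ t in Ioi (0:ℝ), t ^ (N-1) * jacS α β c k t θ φ)
    (fun k hk x hx => (jacI_hasDerivAt hα hβ hc ha hab hb hk hx.1 hφ hx.2).const_mul _) j hj θ hmem
  rw [← key]
  refine Filter.EventuallyEq.iteratedDeriv_eq j ?_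
  filter_upwards [hopen.mem_nhds hmem] with x hx
  unfold tildePotentialKer
  congr 1
  refine setIntegral_congr_fun measurableSet_Ioi fun t ht => ?_
  beta_reduce
  rw [tildePoisson_eq hα hβ hc ha hab hb ht (Ioo_subset_Icc_self hx.1) hφ, mul_comm]



/-! ### Part 10: conclusion -/

lemma abs_rpow_half_integrable (θ : ℝ) : IntegrableOn (fun φ : ℝ => |θ - φ| ^ (-(1/2):ℝ)) (Ioo 0 π) := by
  have h1 : ∀ u v : ℝ, IntervalIntegrable (fun x : ℝ => |x| ^ (-(1/2):ℝ)) volume u v := by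
    have hz : ∀ v : ℝ, 0 ≤ v → IntervalIntegrable (fun x : ℝ => |x| ^ (-(1/2):ℝ)) volume 0 v := by
      intro v hv
      refine (intervalIntegral.intervalIntegrable_rpow' (a := 0) (b := v) (r := -(1/2)) (by norm_num)).congr ?_
      intro x hx
      rw [uIoc_of_le hv] at hx
      simp only [abs_of_pos hx.1]
    have hz' : ∀ v : ℝ, IntervalIntegrable (fun x : ℝ => |x| ^ (-(1/2):ℝ)) volume 0 v := by
      intro v
      rcases le_total 0 v with hv | hv
      · exact hz v hv
      · rw [IntervalIntegrable.iff_comp_neg]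
        simpa using hz (-v) (by linarith)
    exact fun u v => (hz' u).symm.trans (hz' v)
  have h2 := (h1 (θ - 0) (θ - π)).comp_sub_left θ
  simp only [sub_sub_cancel] at h2
  exact (intervalIntegrable_iff_integrableOn_Ioo_of_le Real.pi_pos.le).1 h2

lemma jac_kernel_phi_integrable {α β : ℝ} {a b : ℝ} (ha : 0 < a) (hb : b < π)
    {f : ℝ → ℝ} (hf : Continuous f) (hs : tsupport f ⊆ Ioo a b) (θ : ℝ) :
    Integrable (fun φ => |θ - φ| ^ (-(1/2):ℝ) * |f φ|) (jacobiMeasure α β) := by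
  rw [jac_integrable]
  have hsub : ∀ x ∈ Icc a b, x ∈ Ioo 0 π := fun x hx => ⟨ha.trans_le hx.1, hx.2.trans_lt hb⟩
  have hc : ContinuousOn (fun x => jacW α β x * |f x|) (Icc a b) :=
    ((jacW_continuousOn α β).mono hsub).mul hf.abs.continuousOn
  obtain ⟨C, hC⟩ := isCompact_Icc.exists_bound_of_continuousOn hc
  refine Integrable.mono' ((abs_rpow_half_integrable θ).const_mul (max C 0)) ?_ ?_
  · have h1 : Measurable (fun φ => |θ - φ| ^ (-(1/2):ℝ) * |f φ|) := by
      have := hf.measurable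
      fun_prop
    exact ((jacW_measurable α β).mul h1).aestronglyMeasurable
  · filter_upwards with x
    have hr : 0 ≤ |θ - x| ^ (-(1/2):ℝ) := by positivity
    have e : jacW α β x * (|θ - x| ^ (-(1/2):ℝ) * |f x|) = (jacW α β x * |f x|) * |θ - x| ^ (-(1/2):ℝ) := by ring
    rw [e, norm_mul, Real.norm_of_nonneg hr]
    refine mul_le_mul_of_nonneg_right ?_ hr
    by_cases hx : x ∈ Icc a b
    · exact (hC x hx).trans (le_max_left _ _)
    · rw [jac_zero_of_supp hs fun h => hx (Ioo_subset_Icc_self h)]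
      simp

lemma jac_negpow_bd {α β : ℝ} (hα : -1 < α) (hβ : -1 < β) {c : ℕ → ℝ} (hc : JacobiNormalized α β c) {a b : ℝ}
    (ha : 0 < a) (hab : a < b) (hb : b < π) {f : ℝ → ℝ} (hf : ContDiff ℝ (⊤ : ℕ∞) f)
    (hs : tsupport f ⊆ Ioo a b) {N k : ℕ} (hN : 1 ≤ N) (hk : k ≤ N - 1) :
    ∃ u : ℕ → ℝ, Summable u ∧ ∀ n, ∀ x ∈ Icc a b,
      |(jacLa α β n ^ N)⁻¹ * jacobiInner α β f (nJacobi α β c (n+1)) * iteratedDeriv k (nJacobi α β c (n+1)) x| ≤ u n := by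
  obtain ⟨C1, hC1, h1⟩ := (jac_bounds hα hβ hc ha hab hb k).shift
  obtain ⟨C2, hC2, h2⟩ := jac_coeff hα hβ hc ha hab hb hf hs
  refine ⟨fun n => (C1 * C2 * 6^(N-1) * 2) * (1 / ((n:ℝ)+1)^2), ?_, fun n x hx => ?_⟩
  · refine Summable.mul_left _ ?_
    have := (summable_nat_add_iff 1).2 (Real.summable_one_div_nat_pow.2 (by norm_num : 1 < 2))
    simpa using this
  · have hla := jacLa_pos hα hβ n
    have hla2 := jacLa_lower hα hβ n
    have e1 := (h1 n x hx).2.1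
    have e2 := h2 n
    have hp := jac_pow_le hα hβ hk n
    have hn : (0:ℝ) ≤ n := Nat.cast_nonneg n
    rw [abs_mul, abs_mul, abs_of_pos (by positivity : 0 < (jacLa α β n ^ N)⁻¹)]
    obtain ⟨M, rfl⟩ : ∃ M, N = M + 1 := ⟨N - 1, by omega⟩
    simp only [Nat.add_sub_cancel] at hp ⊢
    have hi : (jacLa α β n)⁻¹ ≤ 2 / ((n:ℝ)+1) := by
      rw [inv_eq_one_div, div_le_div_iff₀ hla (by positivity)]
      linarith
    calc (jacLa α β n ^ (M+1))⁻¹ * |jacobiInner α β f (nJacobi α β c (n+1))| * |iteratedDeriv k (nJacobi α β c (n+1)) x|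
        ≤ (jacLa α β n ^ (M+1))⁻¹ * (C2 / ((n:ℝ)+1)) * (C1 * (6^M * jacLa α β n ^ M)) := by
          gcongr
          exact e1.trans (by gcongr)
      _ = C1 * C2 * 6^M * (1/((n:ℝ)+1)) * (jacLa α β n)⁻¹ := by
          rw [pow_succ]; field_simp
      _ ≤ C1 * C2 * 6^M * (1/((n:ℝ)+1)) * (2 / ((n:ℝ)+1)) := by gcongr
      _ = _ := by field_simp

lemma jac_coef_eq {α β : ℝ} (hα : -1 < α) (hβ : -1 < β) (N n : ℕ) :
    |((n:ℝ)+1) + jacobiTau α β| ^ (-(N:ℝ)) = (jacLa α β n ^ N)⁻¹ := by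
  have := jacLa_pos hα hβ n
  unfold jacLa at this ⊢
  rw [abs_of_pos this, Real.rpow_neg this.le, Real.rpow_natCast]

lemma jacobiNegPow_iteratedDeriv {α β : ℝ} (hα : -1 < α) (hβ : -1 < β) {c : ℕ → ℝ} (hc : JacobiNormalized α β c) {a b : ℝ}
    (ha : 0 < a) (hab : a < b) (hb : b < π) {f : ℝ → ℝ} (hf : ContDiff ℝ (⊤ : ℕ∞) f)
    (hs : tsupport f ⊆ Ioo a b) {N j : ℕ} (hN : 1 ≤ N) (hj : j ≤ N - 1) {θ : ℝ} (hθ : θ ∈ Ioo a b) :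
    iteratedDeriv j (jacobiNegPow α β c N f) θ = ∑' n, (jacLa α β n ^ N)⁻¹ * jacobiInner α β f (nJacobi α β c (n+1)) *
      iteratedDeriv j (nJacobi α β c (n+1)) θ := by
  have key := iteratedDeriv_of_chain isOpen_Ioo (s := Ioo a b) (M := N-1)
    (F := fun k θ => ∑' n, (jacLa α β n ^ N)⁻¹ * jacobiInner α β f (nJacobi α β c (n+1)) *
      iteratedDeriv k (nJacobi α β c (n+1)) θ) (fun k hk x hx => ?_) j hj θ hθ
  · rw [← key]
    congr 1
    ext x
    unfold jacobiNegPow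
    refine tsum_congr fun n => ?_
    rw [jac_coef_eq hα hβ, iteratedDeriv_zero]
  · obtain ⟨u, hu, h⟩ := jac_negpow_bd hα hβ hc ha hab hb hf hs hN (show k+1 ≤ N-1 by omega)
    obtain ⟨v, hv, h'⟩ := jac_negpow_bd hα hβ hc ha hab hb hf hs hN hk.le
    refine hasDerivAt_tsum_of_isPreconnected hu
      (g := fun n θ => (jacLa α β n ^ N)⁻¹ * jacobiInner α β f (nJacobi α β c (n+1)) * iteratedDeriv k (nJacobi α β c (n+1)) θ)
      (g' := fun n θ => (jacLa α β n ^ N)⁻¹ * jacobiInner α β f (nJacobi α β c (n+1)) * iteratedDeriv (k+1) (nJacobi α β c (n+1)) θ)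
      isOpen_Ioo isPreconnected_Ioo (fun n y hy => ?_) (fun n y hy => h n y (Ioo_subset_Icc_self hy)) hx
      (Summable.of_norm_bounded hv fun n => h' n x (Ioo_subset_Icc_self hx)) hx
    have hd : HasDerivAt (iteratedDeriv k (nJacobi α β c (n+1))) (iteratedDeriv (k+1) (nJacobi α β c (n+1)) y) y := by
      rw [iteratedDeriv_succ]
      exact ((nJacobi_contDiff α β c (n+1)).differentiable_iteratedDeriv k (by exact_mod_cast ENat.natCast_lt_top k) y).hasDerivAt
    exact hd.const_mul _

/-- at fixed `t` -/
lemma jac_phi_integral {α β : ℝ} (hα : -1 < α) (hβ : -1 < β) {c : ℕ → ℝ} (hc : JacobiNormalized α β c) {a b : ℝ}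
    (ha : 0 < a) (hab : a < b) (hb : b < π) {f : ℝ → ℝ} (hf : Continuous f) (hcs : HasCompactSupport f)
    (hs : tsupport f ⊆ Ioo a b) (M j : ℕ) {θ t : ℝ} (hθ : θ ∈ Icc a b) (ht : 0 < t) :
    ∫ φ, t ^ M * jacS α β c j t θ φ * f φ ∂(jacobiMeasure α β) =
      ∑' n, t ^ M * Real.exp (-(t * jacLa α β n)) *
        (jacobiInner α β f (nJacobi α β c (n+1)) * iteratedDeriv j (nJacobi α β c (n+1)) θ) := by
  haveI := jac_finite hα hβ hc
  obtain ⟨C, hC, h⟩ := jac_B1 hα hβ hc ha hab hb (le_refl j)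
  obtain ⟨Cf, hCf⟩ := hcs.exists_bound_of_continuous hf
  have hCf0 : 0 ≤ Cf := (norm_nonneg _).trans (hCf 0)
  have hexp := (jac_exp_sum hα hβ ht).1
  have htj := pow_pos ht j
  set D := t ^ M * (C / t^j) * Cf with hD
  have hD0 : 0 ≤ D := by positivity
  have hbd : ∀ n φ, ‖t ^ M * jacT α β c j t θ φ n * f φ‖ ≤ D * Real.exp (-(t * jacLa α β n / 2)) := by
    intro n φ
    by_cases hφ : φ ∈ Icc a b
    · have h1 := h t ht θ hθ φ hφ n
      rw [abs_mul, abs_of_pos htj] at h1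
      have h2 : |jacT α β c j t θ φ n| ≤ C / t^j * Real.exp (-(t * jacLa α β n / 2)) := by
        rw [div_mul_eq_mul_div, le_div_iff₀ htj]; linarith
      rw [norm_mul, norm_mul, Real.norm_of_nonneg (pow_nonneg ht.le M), Real.norm_eq_abs]
      calc t ^ M * |jacT α β c j t θ φ n| * ‖f φ‖ ≤ t ^ M * (C / t^j * Real.exp (-(t * jacLa α β n / 2))) * Cf := by
            gcongr; exact hCf φ
        _ = _ := by rw [hD]; ring
    · rw [jac_zero_of_supp hs fun h => hφ (Ioo_subset_Icc_self h), mul_zero, norm_zero]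
      positivity
  have hpc : ∀ n, Continuous (nJacobi α β c n) := fun n => (nJacobi_contDiff α β c n).continuous
  have hint : ∀ n, Integrable (fun φ => t ^ M * jacT α β c j t θ φ n * f φ) (jacobiMeasure α β) := by
    intro n
    refine Integrable.of_bound (Continuous.aestronglyMeasurable ?_) _ (Filter.Eventually.of_forall (hbd n))
    unfold jacT
    have := hpc (n+1)
    fun_prop
  have hsum : Summable fun n => ∫ φ, ‖t ^ M * jacT α β c j t θ φ n * f φ‖ ∂(jacobiMeasure α β) := by
    refine Summable.of_nonneg_of_le (fun n => integral_nonneg fun φ => norm_nonneg _) (fun n => ?_)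
      (hexp.mul_left (D * (jacobiMeasure α β).real univ))
    have := integral_mono (hint n).norm (integrable_const (D * Real.exp (-(t * jacLa α β n / 2)))) (hbd n)
    refine this.trans (le_of_eq ?_)
    rw [integral_const, smul_eq_mul]
    ring
  have := hasSum_integral_of_summable_integral_norm hint hsum
  have e1 : ∀ φ, t ^ M * jacS α β c j t θ φ * f φ = ∑' n, t ^ M * jacT α β c j t θ φ n * f φ := by
    intro φ
    unfold jacS
    rw [tsum_mul_right, tsum_mul_left]
  simp only [e1]
  rw [← this.tsum_eq]
  refine tsum_congr fun n => ?_
  unfold jacT jacobiInner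
  rw [← integral_mul_const, ← integral_const_mul]
  congr 1
  ext φ
  ring

lemma jac_t_integral {α β : ℝ} (hα : -1 < α) (hβ : -1 < β) {c : ℕ → ℝ} (hc : JacobiNormalized α β c) {a b : ℝ}
    (ha : 0 < a) (hab : a < b) (hb : b < π) {f : ℝ → ℝ} (hf : ContDiff ℝ (⊤ : ℕ∞) f)
    (hs : tsupport f ⊆ Ioo a b) {N j : ℕ} (hN : 1 ≤ N) (hj : j ≤ N - 1) {θ : ℝ} (hθ : θ ∈ Icc a b) :
    ∫ t in Ioi (0:ℝ), ∑' n, t ^ (N-1) * Real.exp (-(t * jacLa α β n)) *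
        (jacobiInner α β f (nJacobi α β c (n+1)) * iteratedDeriv j (nJacobi α β c (n+1)) θ) =
      Real.Gamma N * ∑' n, (jacLa α β n ^ N)⁻¹ * jacobiInner α β f (nJacobi α β c (n+1)) *
      iteratedDeriv j (nJacobi α β c (n+1)) θ := by
  obtain ⟨u, hu, h⟩ := jac_negpow_bd hα hβ hc ha hab hb hf hs hN hj
  have hN0 : (0:ℝ) < N := by exact_mod_cast hN
  have hrp : ∀ n, ∀ t ∈ Ioi (0:ℝ), t ^ ((N:ℝ)-1) * Real.exp (-(jacLa α β n * t)) = t ^ (N-1) * Real.exp (-(t * jacLa α β n)) := by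
    intro n t ht
    rw [mul_comm t, ← Real.rpow_natCast t (N-1), Nat.cast_sub hN, Nat.cast_one]
  have hi : ∀ n, ∫ t in Ioi (0:ℝ), t ^ (N-1) * Real.exp (-(t * jacLa α β n)) = Real.Gamma N * (jacLa α β n ^ N)⁻¹ := by
    intro n
    rw [← setIntegral_congr_fun measurableSet_Ioi (hrp n), Real.integral_rpow_mul_exp_neg_mul_Ioi hN0 (jacLa_pos hα hβ n),
      Real.rpow_natCast, one_div, inv_pow]
    ring
  have hG : 0 < Real.Gamma N := Real.Gamma_pos_of_pos hN0
  have hint0 : ∀ n, IntegrableOn (fun t : ℝ => t ^ (N-1) * Real.exp (-(t * jacLa α β n))) (Ioi 0) := by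
    intro n
    by_contra hcon
    have h0 := hi n
    rw [integral_undef hcon] at h0
    have := jacLa_pos hα hβ n
    have : 0 < Real.Gamma N * (jacLa α β n ^ N)⁻¹ := by positivity
    linarith
  have hsum : Summable fun n => ∫ t in Ioi (0:ℝ), ‖t ^ (N-1) * Real.exp (-(t * jacLa α β n)) *
        (jacobiInner α β f (nJacobi α β c (n+1)) * iteratedDeriv j (nJacobi α β c (n+1)) θ)‖ := by
    refine Summable.of_nonneg_of_le (fun n => integral_nonneg fun φ => norm_nonneg _) (fun n => ?_)
      (hu.mul_left (Real.Gamma N))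
    have e : ∫ t in Ioi (0:ℝ), ‖t ^ (N-1) * Real.exp (-(t * jacLa α β n)) *
        (jacobiInner α β f (nJacobi α β c (n+1)) * iteratedDeriv j (nJacobi α β c (n+1)) θ)‖ =
        ∫ t in Ioi (0:ℝ), t ^ (N-1) * Real.exp (-(t * jacLa α β n)) *
        |jacobiInner α β f (nJacobi α β c (n+1)) * iteratedDeriv j (nJacobi α β c (n+1)) θ| := by
      refine setIntegral_congr_fun measurableSet_Ioi fun t ht => ?_
      have ht' : 0 < t := ht
      rw [norm_mul, Real.norm_of_nonneg (by positivity), Real.norm_eq_abs]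
    rw [e, integral_mul_const, hi n, mul_assoc]
    refine mul_le_mul_of_nonneg_left ?_ hG.le
    have := h n θ hθ
    have hp : 0 < (jacLa α β n ^ N)⁻¹ := by have := jacLa_pos hα hβ n; positivity
    rwa [mul_assoc, abs_mul, abs_of_pos hp] at this
  have := hasSum_integral_of_summable_integral_norm (fun n => (hint0 n).mul_const _) hsum
  rw [← this.tsum_eq, ← tsum_mul_left]
  refine tsum_congr fun n => ?_
  rw [integral_mul_const, hi n]
  ring

lemma jac_fubini_integrable {α β : ℝ} (hα : -1 < α) (hβ : -1 < β) {c : ℕ → ℝ} (hc : JacobiNormalized α β c) {a b : ℝ}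
    (ha : 0 < a) (hab : a < b) (hb : b < π) {f : ℝ → ℝ} (hf : Continuous f)
    (hs : tsupport f ⊆ Ioo a b) {M j : ℕ} (hj : j ≤ M) {θ : ℝ} (hθ : θ ∈ Icc a b) :
    Integrable (Function.uncurry fun t φ => t ^ M * jacS α β c j t θ φ * f φ)
      ((volume.restrict (Ioi 0)).prod (jacobiMeasure α β)) := by
  haveI := jac_finite hα hβ hc
  obtain ⟨C, hC, h⟩ := jac_kernel_bd hα hβ hc ha hab hb hj
  have hpc : ∀ n, Continuous (nJacobi α β c n) := fun n => (nJacobi_contDiff α β c n).continuous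
  have hae1 : ∀ᵐ z : ℝ × ℝ ∂((volume.restrict (Ioi 0)).prod (jacobiMeasure α β)), 0 < z.1 :=
    Measure.quasiMeasurePreserving_fst.ae (ae_restrict_mem measurableSet_Ioi)
  have hae2 : ∀ᵐ z : ℝ × ℝ ∂((volume.restrict (Ioi 0)).prod (jacobiMeasure α β)), z.2 ≠ θ := by
    refine Measure.quasiMeasurePreserving_snd.ae (p := fun φ => φ ≠ θ) ?_
    have hac : jacobiMeasure α β ≪ volume :=
      (withDensity_absolutelyContinuous _ _).trans Measure.absolutelyContinuous_restrict
    exact hac.ae_le (Measure.ae_ne volume θ)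
  refine Integrable.mono' ((jac_t_integrable.const_mul C).mul_prod (jac_kernel_phi_integrable (α := α) (β := β) ha hb hf hs θ)) ?_ ?_
  · have e1 : (Function.uncurry fun t φ => t ^ M * jacS α β c j t θ φ * f φ) =
        fun z : ℝ × ℝ => ∑' n, z.1 ^ M * jacT α β c j z.1 θ z.2 n * f z.2 := by
      ext z
      simp only [Function.uncurry, jacS]
      rw [tsum_mul_right, tsum_mul_left]
    rw [e1]
    refine aesm_tsum (fun n => Continuous.aestronglyMeasurable ?_) ?_
    · unfold jacT
      have := hpc (n+1)
      fun_prop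
    · filter_upwards [hae1] with z hz
      by_cases hφ : z.2 ∈ Icc a b
      · exact ((jacT_summable hα hβ hc ha hab hb j hz hθ hφ).mul_left _).mul_right _
      · simp only [jac_zero_of_supp hs fun h => hφ (Ioo_subset_Icc_self h), mul_zero]
        exact summable_zero
  · filter_upwards [hae1, hae2] with z hz hz2
    simp only [Function.uncurry]
    by_cases hφ : z.2 ∈ Icc a b
    · rw [norm_mul, Real.norm_eq_abs, Real.norm_eq_abs, ← mul_assoc]
      exact mul_le_mul_of_nonneg_right (h z.1 hz θ hθ z.2 hφ hz2.symm) (abs_nonneg _)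
    · simp [jac_zero_of_supp hs fun h => hφ (Ioo_subset_Icc_self h)]

lemma exists_window {f : ℝ → ℝ} (hf : IsCcSmooth f) {θ : ℝ} (hθ : θ ∈ Ioo 0 π) :
    ∃ a b, 0 < a ∧ a < b ∧ b < π ∧ θ ∈ Ioo a b ∧ tsupport f ⊆ Ioo a b := by
  obtain ⟨-, hcs, hsub⟩ := hf
  have hK : IsCompact (insert θ (tsupport f)) := hcs.isCompact.insert θ
  have hne : (insert θ (tsupport f)).Nonempty := insert_nonempty _ _
  have hsubK : insert θ (tsupport f) ⊆ Ioo 0 π := insert_subset hθ hsub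
  obtain ⟨m, hm, hm'⟩ := hK.exists_isLeast hne
  obtain ⟨M, hM, hM'⟩ := hK.exists_isGreatest hne
  have h1 := hsubK hm
  have h2 := hsubK hM
  have h3 : m ≤ M := hm' hM
  have hin : ∀ x ∈ insert θ (tsupport f), x ∈ Ioo (m/2) ((M+π)/2) := fun x hx =>
    ⟨by linarith [hm' hx, h1.1], by linarith [hM' hx, h2.2]⟩
  exact ⟨m/2, (M+π)/2, by linarith [h1.1], by linarith [h1.1, h2.2], by linarith [h2.2], hin θ (mem_insert _ _),
    fun x hx => hin x (mem_insert_of_mem _ hx)⟩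

/-- for `0 ≤ j ≤ N−1`, `f ∈ C_c^∞(0,π)` and `θ ∈ (0,π)`:
`∂_θ^j (𝒥^{−N/2}Π₀f)(θ) = ∫₀^π ∂_θ^j K̃_{N/2}(θ,φ) f(φ) dμ(φ)`, the integral converging
absolutely. -/
theorem jacobi_neg_pow_derivative_integral_representation
    (α β : ℝ) (hα : -1 < α) (hβ : -1 < β)
    (c : ℕ → ℝ) (hc : JacobiNormalized α β c)
    (N : ℕ) (hN : 1 ≤ N) (j : ℕ) (hj : j ≤ N - 1)
    (f : ℝ → ℝ) (hf : IsCcSmooth f) (θ : ℝ) (hθ : θ ∈ Set.Ioo 0 π) :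
    Integrable
      (fun φ => iteratedDeriv j (fun θ' => tildePotentialKer α β c N θ' φ) θ * f φ)
      (jacobiMeasure α β) ∧
    iteratedDeriv j (jacobiNegPow α β c N f) θ =
      ∫ φ, iteratedDeriv j (fun θ' => tildePotentialKer α β c N θ' φ) θ * f φ
        ∂(jacobiMeasure α β) := by
  obtain ⟨a, b, ha, hab, hb, hθ', hs⟩ := exists_window hf hθ
  obtain ⟨hfs, hcs, -⟩ := hf
  haveI := jac_finite hα hβ hc
  have hθI := Ioo_subset_Icc_self hθ'
  have hF := jac_fubini_integrable hα hβ hc ha hab hb hfs.continuous hs hj hθI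
  have hac : jacobiMeasure α β ≪ volume :=
    (withDensity_absolutelyContinuous _ _).trans Measure.absolutelyContinuous_restrict
  have hae : (fun φ => (1 / Real.Gamma (N:ℝ)) * ∫ t in Ioi (0:ℝ), t ^ (N-1) * jacS α β c j t θ φ * f φ)
      =ᵐ[jacobiMeasure α β] (fun φ => iteratedDeriv j (fun θ' => tildePotentialKer α β c N θ' φ) θ * f φ) := by
    filter_upwards [hac.ae_le (Measure.ae_ne volume θ)] with φ hne
    by_cases hφ : φ ∈ Icc a b
    · rw [tildePotential_iteratedDeriv hα hβ hc ha hab hb hj hθ' hφ (Ne.symm hne), integral_mul_const, mul_assoc]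
    · simp [jac_zero_of_supp hs fun h => hφ (Ioo_subset_Icc_self h)]
  have hGp : 0 < Real.Gamma N := Real.Gamma_pos_of_pos (by exact_mod_cast hN)
  refine ⟨(hF.integral_prod_right.const_mul _).congr hae, ?_⟩
  rw [← integral_congr_ae hae, integral_const_mul, ← integral_integral_swap hF,
    setIntegral_congr_fun measurableSet_Ioi (fun t ht =>
      jac_phi_integral hα hβ hc ha hab hb hfs.continuous hcs hs (N-1) j hθI ht),
    jac_t_integral hα hβ hc ha hab hb hfs hs hN hj hθI,
    jacobiNegPow_iteratedDeriv hα hβ hc ha hab hb hfs hs hN hj hθ']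
  field_simp


end
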